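/- Suppose K has characteristic zero and a_1 = 0. Set d = Σ_{j=1}^{n+2} b_j − Σ_{i=1}^n a_i and d' = Σ_{i=1}^n (b_i − a_i). If either (a) d is even and d' + 2 + b_{n+1} > b_{n+2}, or (b) d is odd and d' + 1 + b_{n+1} > b_{n+2}, then M has the Weak Lefschetz Property. -/

import Mathlib

open MvPolynomial

noncomputable section

/-- The height (codimension) of an ideal: the infimum of the heights of the
prime ideals containing it. -/
def idealHeight {R : Type*} [CommRing R] (I : Ideal R) : ℕ∞ :=
  ⨅ (p : PrimeSpectrum R) (_ : I ≤ p.asIdeal), Order.height p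

/-- The degree-`z` homogeneous component of `K[x₁, …, x_r]`, for `z : ℤ`
(it is zero in negative degrees). -/
def hcomp (K : Type*) [Field K] (r : ℕ) (z : ℤ) : Submodule K (MvPolynomial (Fin r) K) :=
  if 0 ≤ z then homogeneousSubmodule (Fin r) K z.toNat else ⊥

/-- The degree-`t` graded piece of the cokernel `M` of the graded map
`φ : ⊕_j R(-b j) → ⊕_i R(-a i)`. -/
def cokerPiece {K : Type*} [Field K] {n m : ℕ}
    (φ : Matrix (Fin n) (Fin m) (MvPolynomial (Fin 3) K)) (a : Fin n → ℤ) (t : ℤ) :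
    Submodule K ((Fin n → MvPolynomial (Fin 3) K) ⧸ LinearMap.range φ.mulVecLin) :=
  (Submodule.pi Set.univ fun i => hcomp K 3 (t - a i)).map
    ((LinearMap.range φ.mulVecLin).mkQ.restrictScalars K)

end

namespace LefschetzRankTwo

open Matrix

/-! ### Matrices with two more columns than rows -/

section Cramer

variable {R : Type*} [CommRing R] {N : Type*} [Fintype N] [DecidableEq N]

/-- The determinant of the square matrix obtained by stacking the rows `lam`, `mu` on top of `φ`. -/
def stackDet (φ : Matrix N (Fin 2 ⊕ N) R) (lam mu : Fin 2 ⊕ N → R) : R :=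
  (fromRows (of ![lam, mu]) φ).det

lemma stackDet_eq_updateRow_left (φ : Matrix N (Fin 2 ⊕ N) R) (lam mu : Fin 2 ⊕ N → R) :
    stackDet φ lam mu = ((fromRows (of ![0, mu]) φ).updateRow (Sum.inl 0) lam).det := by
  unfold stackDet
  congr 1
  ext (i | i) j
  · fin_cases i <;> simp [updateRow_apply]
  · simp [updateRow_apply]

lemma stackDet_eq_updateRow_right (φ : Matrix N (Fin 2 ⊕ N) R) (lam mu : Fin 2 ⊕ N → R) :
    stackDet φ lam mu = ((fromRows (of ![lam, 0]) φ).updateRow (Sum.inl 1) mu).det := by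
  unfold stackDet
  congr 1
  ext (i | i) j
  · fin_cases i <;> simp [updateRow_apply]
  · simp [updateRow_apply]

lemma stackDet_add_right (φ : Matrix N (Fin 2 ⊕ N) R) (lam mu nu : Fin 2 ⊕ N → R) :
    stackDet φ lam (mu + nu) = stackDet φ lam mu + stackDet φ lam nu := by
  simp only [stackDet_eq_updateRow_right, det_updateRow_add]

lemma stackDet_smul_right (φ : Matrix N (Fin 2 ⊕ N) R) (lam mu : Fin 2 ⊕ N → R) (r : R) :
    stackDet φ lam (r • mu) = r * stackDet φ lam mu := by
  simp only [stackDet_eq_updateRow_right, det_updateRow_smul]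

lemma stackDet_add_left (φ : Matrix N (Fin 2 ⊕ N) R) (lam mu nu : Fin 2 ⊕ N → R) :
    stackDet φ (lam + mu) nu = stackDet φ lam nu + stackDet φ mu nu := by
  simp only [stackDet_eq_updateRow_left, det_updateRow_add]

lemma stackDet_smul_left (φ : Matrix N (Fin 2 ⊕ N) R) (lam mu : Fin 2 ⊕ N → R) (r : R) :
    stackDet φ (r • lam) mu = r * stackDet φ lam mu := by
  simp only [stackDet_eq_updateRow_left, det_updateRow_smul]

/-- `stackDet` as a bilinear form. -/
def stackForm (φ : Matrix N (Fin 2 ⊕ N) R) :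
    (Fin 2 ⊕ N → R) →ₗ[R] (Fin 2 ⊕ N → R) →ₗ[R] R :=
  LinearMap.mk₂ R (stackDet φ) (stackDet_add_left φ) (fun r m n => stackDet_smul_left φ m n r)
    (stackDet_add_right φ) (fun r m n => stackDet_smul_right φ m n r)

@[simp] lemma stackForm_apply (φ : Matrix N (Fin 2 ⊕ N) R) (lam mu : Fin 2 ⊕ N → R) :
    stackForm φ lam mu = stackDet φ lam mu := rfl

lemma stackDet_row_right (φ : Matrix N (Fin 2 ⊕ N) R) (lam : Fin 2 ⊕ N → R) (i : N) :
    stackDet φ lam (φ i) = 0 :=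
  det_zero_of_row_eq (i := Sum.inl 1) (j := Sum.inr i) (by simp) rfl

lemma stackDet_row_left (φ : Matrix N (Fin 2 ⊕ N) R) (lam : Fin 2 ⊕ N → R) (i : N) :
    stackDet φ (φ i) lam = 0 :=
  det_zero_of_row_eq (i := Sum.inl 0) (j := Sum.inr i) (by simp) rfl

lemma stackDet_self (φ : Matrix N (Fin 2 ⊕ N) R) (lam : Fin 2 ⊕ N → R) :
    stackDet φ lam lam = 0 :=
  det_zero_of_row_eq (i := Sum.inl 0) (j := Sum.inl 1) (by simp) rfl

lemma eq_sum_smul_single (lam : Fin 2 ⊕ N → R) :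
    lam = ∑ k, lam k • (Pi.single k 1 : Fin 2 ⊕ N → R) := pi_eq_sum_univ' lam

lemma stackDet_left_expand (φ : Matrix N (Fin 2 ⊕ N) R) (lam mu : Fin 2 ⊕ N → R) :
    stackDet φ lam mu = ∑ k, lam k * stackDet φ (Pi.single k 1) mu := by
  conv_lhs => rw [← stackForm_apply, eq_sum_smul_single lam]
  simp

/-- The Cramer syzygy attached to a functional `lam`. -/
def cram (φ : Matrix N (Fin 2 ⊕ N) R) :
    (Fin 2 ⊕ N → R) →ₗ[R] (Fin 2 ⊕ N → R) :=
  LinearMap.pi fun k => stackForm φ (Pi.single k 1)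

@[simp] lemma cram_apply (φ : Matrix N (Fin 2 ⊕ N) R) (lam : Fin 2 ⊕ N → R) (k : Fin 2 ⊕ N) :
    cram φ lam k = stackDet φ (Pi.single k 1) lam := rfl

lemma cram_vecMul (φ : Matrix N (Fin 2 ⊕ N) R) (c : N → R) : cram φ (c ᵥ* φ) = 0 := by
  have : c ᵥ* φ = ∑ i, c i • φ i := by
    ext j; simp [vecMul, dotProduct]
  rw [this, map_sum]
  refine Finset.sum_eq_zero fun i _ => ?_
  rw [map_smul]
  ext k
  simp [stackDet_row_right]

/-- Cramer's rule for elements of the kernel. -/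
lemma stackDet_mul_apply (φ : Matrix N (Fin 2 ⊕ N) R) {u : Fin 2 ⊕ N → R} (hu : φ *ᵥ u = 0)
    (lam mu : Fin 2 ⊕ N → R) (k : Fin 2 ⊕ N) :
    stackDet φ lam mu * u k = (lam ⬝ᵥ u) * stackDet φ (Pi.single k 1) mu +
      (mu ⬝ᵥ u) * stackDet φ lam (Pi.single k 1) := by
  set P := fromRows (of ![lam, mu]) φ with hP
  have h0 : P *ᵥ u = Sum.elim ![lam ⬝ᵥ u, mu ⬝ᵥ u] 0 := by
    rw [hP, fromRows_mulVec, hu]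
    congr 1
    ext i; fin_cases i <;> rfl
  have h1 : P.adjugate *ᵥ (P *ᵥ u) = P.det • u := by
    rw [mulVec_mulVec, adjugate_mul, smul_mulVec, one_mulVec]
  have h2 := congrFun h1 k
  rw [h0] at h2
  simp only [mulVec, dotProduct, Fintype.sum_sum_type, Fin.sum_univ_two, Sum.elim_inl,
    Sum.elim_inr, adjugate_apply, Pi.smul_apply, smul_eq_mul, Pi.zero_apply, mul_zero,
    Finset.sum_const_zero, add_zero, cons_val_zero, cons_val_one] at h2
  have e0 : (P.updateRow (Sum.inl 0) (Pi.single k 1)).det = stackDet φ (Pi.single k 1) mu := by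
    rw [stackDet_eq_updateRow_left]
    congr 1
    ext (i | i) j
    · fin_cases i <;> simp [updateRow_apply, hP]
    · simp [updateRow_apply, hP]
  have e1 : (P.updateRow (Sum.inl 1) (Pi.single k 1)).det = stackDet φ lam (Pi.single k 1) := by
    rw [stackDet_eq_updateRow_right]
    congr 1
    ext (i | i) j
    · fin_cases i <;> simp [updateRow_apply, hP]
    · simp [updateRow_apply, hP]
  rw [e0, e1] at h2
  change P.det * u k = _
  rw [← h2]
  simp only [dotProduct, Fintype.sum_sum_type, Fin.sum_univ_two]
  ring

lemma smul_mem_range_cram (φ : Matrix N (Fin 2 ⊕ N) R) {u : Fin 2 ⊕ N → R} (hu : φ *ᵥ u = 0)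
    (lam mu : Fin 2 ⊕ N → R) : stackDet φ lam mu • u ∈ LinearMap.range (cram φ) := by
  have hskew : ∀ k, stackDet φ lam (Pi.single k 1) = - stackDet φ (Pi.single k 1) lam := by
    intro k
    have h := stackDet_self φ (lam + Pi.single k 1)
    rw [stackDet_add_left, stackDet_add_right, stackDet_add_right, stackDet_self,
      stackDet_self, zero_add, add_zero] at h
    exact eq_neg_of_add_eq_zero_left h
  refine ⟨(lam ⬝ᵥ u) • mu - (mu ⬝ᵥ u) • lam, ?_⟩
  rw [map_sub, map_smul, map_smul]
  ext k
  simp only [Pi.sub_apply, Pi.smul_apply, cram_apply, smul_eq_mul]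
  rw [stackDet_mul_apply φ hu, hskew]
  ring

/-- The matrix selecting the columns `g`. -/
def sel {J M : Type*} [DecidableEq J] (g : M → J) : Matrix J M R := (1 : Matrix J J R).submatrix id g

lemma mul_sel (φ : Matrix N (Fin 2 ⊕ N) R) {M : Type*} (g : M → Fin 2 ⊕ N) :
    φ * (sel g : Matrix _ _ R) = φ.submatrix id g := by
  ext i j; simp [sel, Matrix.mul_apply, Matrix.one_apply]

/-- Two elements of the kernel: their `2 × 2` minors are proportional to the maximal minors. -/
lemma wedge_mul_minor (φ : Matrix N (Fin 2 ⊕ N) R) {u w : Fin 2 ⊕ N → R} (hu : φ *ᵥ u = 0)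
    (hw : φ *ᵥ w = 0) (lam mu : Fin 2 ⊕ N → R) (Z : Matrix (Fin 2 ⊕ N) N R) :
    stackDet φ lam mu * (fromCols (of ![u, w])ᵀ Z).det =
      ((lam ⬝ᵥ u) * (mu ⬝ᵥ w) - (lam ⬝ᵥ w) * (mu ⬝ᵥ u)) * (φ * Z).det := by
  unfold stackDet
  rw [← det_mul, fromRows_mul_fromCols]
  have h : φ * (of ![u, w])ᵀ = 0 := by
    ext i j
    fin_cases j
    · exact congrFun hu i
    · exact congrFun hw i
  rw [h, det_fromBlocks_zero₂₁, det_fin_two]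
  rfl

/-- Every maximal minor of `φ` is a multiple of some `stackDet`. -/
lemma exists_stackDet_dvd_minor (φ : Matrix N (Fin 2 ⊕ N) R) (g : N → Fin 2 ⊕ N) :
    ∃ (j k : Fin 2 ⊕ N) (r : R),
      (φ.submatrix id g).det = r * stackDet φ (Pi.single j 1) (Pi.single k 1) := by
  classical
  by_cases hg : Function.Injective g
  · have hc : Fintype.card (Fin 2) = Fintype.card ↥(Set.range g)ᶜ := by
      rw [Fintype.card_compl_set, Set.card_range_of_injective hg]; simp
    let h' := Fintype.equivOfCardEq hc
    let h : Fin 2 → Fin 2 ⊕ N := fun i => h' i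
    have hh : Function.Injective h := fun x y hxy => h'.injective (Subtype.ext hxy)
    have hgh : ∀ i x, h i ≠ g x := fun i x hx => (h' i).2 ⟨x, hx.symm⟩
    refine ⟨h 0, h 1, (fromCols (sel h) (sel g)).det, ?_⟩
    unfold stackDet
    rw [mul_comm, ← det_mul, fromRows_mul_fromCols, mul_sel, mul_sel]
    have e1 : (of ![Pi.single (h 0) 1, Pi.single (h 1) 1] : Matrix (Fin 2) _ R) * (sel h : Matrix _ _ R) = 1 := by
      ext i j
      fin_cases i <;>
        simp [sel, Matrix.mul_apply, Matrix.one_apply, Pi.single_apply, hh.eq_iff, eq_comm]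
    have e2 : (of ![Pi.single (h 0) 1, Pi.single (h 1) 1] : Matrix (Fin 2) _ R) * (sel g : Matrix _ _ R) = 0 := by
      ext i j
      fin_cases i <;> simp [sel, Matrix.mul_apply, Matrix.one_apply, hgh]
    rw [e1, e2, det_fromBlocks_zero₁₂, det_one, one_mul]
  · refine ⟨Sum.inl 0, Sum.inl 0, 0, ?_⟩
    rw [zero_mul]
    simp only [Function.Injective, not_forall] at hg
    obtain ⟨x, y, hxy, hne⟩ := hg
    exact det_zero_of_column_eq hne fun i => by simp [hxy]

/-- The ideal of maximal minors of `φ`. -/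
def minorIdeal (φ : Matrix N (Fin 2 ⊕ N) R) : Ideal R :=
  Ideal.span (Set.range fun g : N → Fin 2 ⊕ N => (φ.submatrix id g).det)

lemma minorIdeal_smul_mem (φ : Matrix N (Fin 2 ⊕ N) R) {u : Fin 2 ⊕ N → R} (hu : φ *ᵥ u = 0)
    {r : R} (hr : r ∈ minorIdeal φ) : r • u ∈ LinearMap.range (cram φ) := by
  refine Submodule.span_induction (p := fun r _ => r • u ∈ LinearMap.range (cram φ)) ?_ ?_ ?_ ?_ hr
  · rintro _ ⟨g, rfl⟩
    obtain ⟨j, k, s, h⟩ := exists_stackDet_dvd_minor φ g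
    simp only [h, mul_smul]
    exact Submodule.smul_mem _ _ (smul_mem_range_cram φ hu _ _)
  · simp
  · intro x y _ _ hx hy
    rw [add_smul]; exact add_mem hx hy
  · intro a x _ hx
    rw [smul_assoc]; exact Submodule.smul_mem _ _ hx

lemma exists_stackDet_ne_zero (φ : Matrix N (Fin 2 ⊕ N) R) {r : R} (hr : r ∈ minorIdeal φ)
    (h0 : r ≠ 0) : ∃ j k, stackDet φ (Pi.single j 1) (Pi.single k 1) ≠ 0 := by
  by_contra! h
  apply h0
  have : minorIdeal φ ≤ ⊥ := by
    refine Ideal.span_le.mpr ?_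
    rintro _ ⟨g, rfl⟩
    obtain ⟨j, k, s, hs⟩ := exists_stackDet_dvd_minor φ g
    simp [hs, h]
  simpa using this hr

/-- Multiplying by an element of the minor ideal moves a functional killed by `cram` into the
row space. -/
lemma minorIdeal_smul_mem_range_vecMul [IsDomain R] (φ : Matrix N (Fin 2 ⊕ N) R)
    {lam : Fin 2 ⊕ N → R} (hlam : cram φ lam = 0) {r : R} (hr : r ∈ minorIdeal φ) :
    ∃ c : N → R, r • lam = c ᵥ* φ := by
  suffices r • lam ∈ LinearMap.range φ.vecMulLinear by
    obtain ⟨c, hc⟩ := this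
    exact ⟨c, hc.symm⟩
  by_cases h0 : r = 0
  · simp [h0]
  obtain ⟨j, k, hjk⟩ := exists_stackDet_ne_zero φ hr h0
  have hz : ∀ v, φ *ᵥ v = 0 → lam ⬝ᵥ v = 0 := by
    intro v hv
    have h1 := stackDet_mul_apply φ hv (Pi.single j 1) lam k
    have h2 : stackDet φ (Pi.single j 1) lam = 0 := congrFun hlam j
    have h3 : stackDet φ (Pi.single k 1) lam = 0 := congrFun hlam k
    rw [h2, h3] at h1
    simpa [hjk] using h1.symm
  refine Submodule.span_induction (p := fun r _ => r • lam ∈ LinearMap.range φ.vecMulLinear)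
    ?_ ?_ ?_ ?_ hr
  · rintro _ ⟨g, rfl⟩
    refine ⟨lam ᵥ* ((sel g : Matrix _ _ R) * (φ.submatrix id g).adjugate), ?_⟩
    rw [vecMulLinear_apply, vecMul_vecMul]
    ext t
    have := hz ((φ.submatrix id g).det • Pi.single t 1 -
      ((sel g : Matrix _ _ R) * (φ.submatrix id g).adjugate * φ) *ᵥ Pi.single t 1) (by
        rw [mulVec_sub, mulVec_smul, mulVec_mulVec, ← Matrix.mul_assoc, ← Matrix.mul_assoc,
          mul_sel, mul_adjugate, smul_mul, Matrix.one_mul, smul_mulVec, sub_self])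
    rw [dotProduct_sub, sub_eq_zero, dotProduct_mulVec] at this
    simpa using this.symm
  · simp
  · intro x y _ _ hx hy
    rw [add_smul]; exact add_mem hx hy
  · intro a x _ hx
    rw [smul_assoc]; exact Submodule.smul_mem _ _ hx

lemma vecMul_injective [IsDomain R] (φ : Matrix N (Fin 2 ⊕ N) R) {r : R}
    (hr : r ∈ minorIdeal φ) (h0 : r ≠ 0) : Function.Injective (fun c : N → R => c ᵥ* φ) := by
  intro c c' h
  have hcc : (c - c') ᵥ* φ = 0 := by rw [sub_vecMul]; exact sub_eq_zero.mpr h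
  suffices h : ∀ r ∈ minorIdeal φ, r • (c - c') = 0 by
    exact sub_eq_zero.mp ((smul_eq_zero.mp (h r hr)).resolve_left h0)
  intro r hr
  refine Submodule.span_induction (p := fun r _ => r • (c - c') = 0) ?_ ?_ ?_ ?_ hr
  · rintro _ ⟨g, rfl⟩
    have h1 : (c - c') ᵥ* (φ * (sel g : Matrix _ _ R) * (φ.submatrix id g).adjugate) = 0 := by
      rw [Matrix.mul_assoc, ← vecMul_vecMul, hcc, zero_vecMul]
    rw [mul_sel, mul_adjugate] at h1
    simpa [vecMul_smul] using h1
  · simp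
  · intro x y _ _ hx hy
    rw [add_smul, hx, hy, add_zero]
  · intro a x _ hx
    rw [smul_assoc, hx, smul_zero]

end Cramer

/-! ### Exactness of the Buchsbaum-Rim complex -/

section BuchsbaumRim

variable {K : Type*} [Field K] {N : Type*} [Fintype N] [DecidableEq N]

lemma mem_span_X_zero_one {q : MvPolynomial (Fin 3) K}
    (h : ∃ r s, X 2 * q = X 0 * r + X 1 * s) : ∃ r s, q = X 0 * r + X 1 * s := by
  obtain ⟨r, s, hrs⟩ := h
  have hspan : ∀ {q : MvPolynomial (Fin 3) K},
      q ∈ Ideal.span ((X : Fin 3 → MvPolynomial (Fin 3) K) '' {0, 1}) ↔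
        ∃ r s, q = X 0 * r + X 1 * s := by
    intro q
    rw [Set.image_pair, Ideal.mem_span_pair]
    exact ⟨fun ⟨a, b, h⟩ => ⟨a, b, by rw [← h]; ring⟩, fun ⟨a, b, h⟩ => ⟨a, b, by rw [h]; ring⟩⟩
  rw [← hspan, mem_ideal_span_X_image]
  have h1 : X 2 * q ∈ Ideal.span ((X : Fin 3 → MvPolynomial (Fin 3) K) '' {0, 1}) :=
    hspan.mpr ⟨r, s, hrs⟩
  rw [mem_ideal_span_X_image] at h1
  intro m hm
  obtain ⟨i, hi, hne⟩ := h1 (Finsupp.single 2 1 + m) (by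
    rw [mem_support_iff, coeff_X_mul]; exact mem_support_iff.mp hm)
  refine ⟨i, hi, ?_⟩
  have : (Finsupp.single (2 : Fin 3) 1) i = 0 := by
    rcases hi with rfl | rfl <;> simp
  simpa [this] using hne

lemma X_dvd_of_X_mul_eq {i j : Fin 3} (hij : i ≠ j) {p q : MvPolynomial (Fin 3) K} {k l : ℕ}
    (h : X j ^ l * p = X i ^ k * q) : X i ^ k ∣ p := by
  refine (Prime.pow_dvd_of_dvd_mul_left (X_prime (i := i)) k ?_ ⟨q, h⟩)
  intro hd
  exact hij ((X_dvd_X (σ := Fin 3) (R := K)).mp ((X_prime (i := i)).dvd_of_dvd_pow hd))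

variable {φ : Matrix N (Fin 2 ⊕ N) (MvPolynomial (Fin 3) K)}

lemma exists_vecMul_of_cram_eq_zero {M : ℕ}
    (hI : ∀ i, X i ^ M ∈ minorIdeal φ) {lam : Fin 2 ⊕ N → MvPolynomial (Fin 3) K}
    (h : cram φ lam = 0) : ∃ c, lam = c ᵥ* φ := by
  obtain ⟨c, hc⟩ := minorIdeal_smul_mem_range_vecMul φ h (hI 0)
  obtain ⟨d, hd⟩ := minorIdeal_smul_mem_range_vecMul φ h (hI 1)
  have hinj := vecMul_injective φ (hI 0) (pow_ne_zero _ (X_ne_zero _))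
  have hcd : (X 1 ^ M : MvPolynomial (Fin 3) K) • c = (X 0 ^ M : MvPolynomial (Fin 3) K) • d := by
    apply hinj
    simp only [smul_vecMul]
    rw [← hc, ← hd, smul_comm]
  have hdvd : ∀ i, (X 0 ^ M : MvPolynomial (Fin 3) K) ∣ c i := fun i =>
    X_dvd_of_X_mul_eq (by decide) (congrFun hcd i)
  choose e he using hdvd
  refine ⟨e, ?_⟩
  have : c = (X 0 ^ M : MvPolynomial (Fin 3) K) • e := funext he
  rw [this, smul_vecMul] at hc
  exact smul_right_injective _ (pow_ne_zero M (X_ne_zero (R := K) (0 : Fin 3))) hc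

lemma mem_range_cram_of_X_smul {M : ℕ}
    (hI : ∀ i, X i ^ M ∈ minorIdeal φ) {u : Fin 2 ⊕ N → MvPolynomial (Fin 3) K}
    (h : ∀ i : Fin 3, (X i : MvPolynomial (Fin 3) K) • u ∈ LinearMap.range (cram φ)) :
    u ∈ LinearMap.range (cram φ) := by
  obtain ⟨l0, h0⟩ := h 0
  obtain ⟨l1, h1⟩ := h 1
  obtain ⟨l2, h2⟩ := h 2
  have hinj := vecMul_injective φ (hI 0) (pow_ne_zero _ (X_ne_zero _))
  obtain ⟨c, hc⟩ := exists_vecMul_of_cram_eq_zero hI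
    (lam := (X 1 : MvPolynomial (Fin 3) K) • l0 - (X 0 : MvPolynomial (Fin 3) K) • l1) (by
      rw [map_sub, map_smul, map_smul, h0, h1, smul_comm, sub_self])
  obtain ⟨b, hb⟩ := exists_vecMul_of_cram_eq_zero hI
    (lam := (X 2 : MvPolynomial (Fin 3) K) • l0 - (X 0 : MvPolynomial (Fin 3) K) • l2) (by
      rw [map_sub, map_smul, map_smul, h0, h2, smul_comm, sub_self])
  obtain ⟨a, ha⟩ := exists_vecMul_of_cram_eq_zero hI
    (lam := (X 2 : MvPolynomial (Fin 3) K) • l1 - (X 1 : MvPolynomial (Fin 3) K) • l2) (by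
      rw [map_sub, map_smul, map_smul, h1, h2, smul_comm, sub_self])
  have habc : (X 2 : MvPolynomial (Fin 3) K) • c =
      (X 0 : MvPolynomial (Fin 3) K) • (-a) + (X 1 : MvPolynomial (Fin 3) K) • b := by
    apply hinj
    simp only [smul_vecMul, add_vecMul, neg_vecMul]
    rw [← ha, ← hb, ← hc]
    module
  have hsplit : ∀ i, ∃ r s, c i = X 0 * r + X 1 * s := fun i =>
    mem_span_X_zero_one ⟨_, _, congrFun habc i⟩
  choose c1 c2 hc12 using hsplit
  have hcc : c = (X 0 : MvPolynomial (Fin 3) K) • c1 + (X 1 : MvPolynomial (Fin 3) K) • c2 :=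
    funext hc12
  rw [hcc, add_vecMul, smul_vecMul, smul_vecMul] at hc
  have hl : (X 1 : MvPolynomial (Fin 3) K) • (l0 - c2 ᵥ* φ) =
      (X 0 : MvPolynomial (Fin 3) K) • (l1 + c1 ᵥ* φ) := by
    rw [smul_sub, smul_add, sub_eq_iff_eq_add]
    rw [sub_eq_iff_eq_add] at hc
    rw [hc]
    abel
  have hdvd : ∀ j, (X 0 : MvPolynomial (Fin 3) K) ∣ (l0 - c2 ᵥ* φ) j := fun j => by
    simpa using X_dvd_of_X_mul_eq (i := 0) (j := 1) (k := 1) (l := 1) (by decide)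
      (by simpa using congrFun hl j)
  choose e he using hdvd
  have hee : l0 - c2 ᵥ* φ = (X 0 : MvPolynomial (Fin 3) K) • e := funext he
  refine ⟨e, smul_right_injective _ (X_ne_zero (R := K) (0 : Fin 3)) ?_⟩
  simp only
  rw [← map_smul, ← hee, map_sub, cram_vecMul, sub_zero, h0]

/-- The kernel of `φ` is generated by the Cramer syzygies. -/
lemma mem_range_cram {M : ℕ} (hI : ∀ i, X i ^ M ∈ minorIdeal φ)
    {u : Fin 2 ⊕ N → MvPolynomial (Fin 3) K} (hu : φ *ᵥ u = 0) :
    u ∈ LinearMap.range (cram φ) := by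
  suffices h : ∀ (n i j k : ℕ), i + j + k = n → ∀ v : Fin 2 ⊕ N → MvPolynomial (Fin 3) K,
      (X 0 ^ i : MvPolynomial (Fin 3) K) • v ∈ LinearMap.range (cram φ) →
      (X 1 ^ j : MvPolynomial (Fin 3) K) • v ∈ LinearMap.range (cram φ) →
      (X 2 ^ k : MvPolynomial (Fin 3) K) • v ∈ LinearMap.range (cram φ) →
      v ∈ LinearMap.range (cram φ) from
    h _ M M M rfl u (minorIdeal_smul_mem φ hu (hI 0)) (minorIdeal_smul_mem φ hu (hI 1))
      (minorIdeal_smul_mem φ hu (hI 2))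
  have hmul : ∀ (l m : Fin 3) (e : ℕ) (v : Fin 2 ⊕ N → MvPolynomial (Fin 3) K),
      (X l ^ e : MvPolynomial (Fin 3) K) • v ∈ LinearMap.range (cram φ) →
      (X l ^ e : MvPolynomial (Fin 3) K) • (X m : MvPolynomial (Fin 3) K) • v ∈
        LinearMap.range (cram φ) := by
    intro l m e v hv
    rw [smul_comm]
    exact Submodule.smul_mem _ _ hv
  have hpred : ∀ (l : Fin 3) (e : ℕ) (v : Fin 2 ⊕ N → MvPolynomial (Fin 3) K),
      (X l ^ (e + 1) : MvPolynomial (Fin 3) K) • v ∈ LinearMap.range (cram φ) →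
      (X l ^ e : MvPolynomial (Fin 3) K) • (X l : MvPolynomial (Fin 3) K) • v ∈
        LinearMap.range (cram φ) := by
    intro l e v hv
    rwa [smul_smul, ← pow_succ]
  intro n
  induction n with
  | zero =>
    intro i j k hn v h0 _ _
    obtain rfl : i = 0 := by omega
    simpa using h0
  | succ n ih =>
    intro i j k hn v h0 h1 h2
    rcases i with _ | i
    · simpa using h0
    rcases j with _ | j
    · simpa using h1
    rcases k with _ | k
    · simpa using h2
    refine mem_range_cram_of_X_smul hI fun m => ?_
    fin_cases m
    · exact ih i (j + 1) (k + 1) (by omega) _ (hpred 0 _ _ h0) (hmul 1 _ _ _ h1) (hmul 2 _ _ _ h2)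
    · exact ih (i + 1) j (k + 1) (by omega) _ (hmul 0 _ _ _ h0) (hpred 1 _ _ h1) (hmul 2 _ _ _ h2)
    · exact ih (i + 1) (j + 1) k (by omega) _ (hmul 0 _ _ _ h0) (hmul 1 _ _ _ h1) (hpred 2 _ _ h2)

end BuchsbaumRim

/-! ### Graded pieces -/

section Graded

/-- A determinant of homogeneous entries is homogeneous. -/
lemma det_mem_graded {B S J : Type*} [CommRing B] [SetLike S B] [AddSubgroupClass S B]
    (F : ℤ → S) [SetLike.GradedMonoid F] [Fintype J] [DecidableEq J] (P : Matrix J J B)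
    (r c : J → ℤ) (h : ∀ i j, P i j ∈ F (c j - r i)) :
    P.det ∈ F ((∑ j, c j) - ∑ i, r i) := by
  rw [det_apply]
  refine sum_mem fun σ _ => ?_
  have h1 : ∏ i, P (σ i) i ∈ F (∑ i, (c i - r (σ i))) :=
    SetLike.prod_mem_graded F (fun i => c i - r (σ i)) (fun i => P (σ i) i) fun i _ => h _ _
  rw [Finset.sum_sub_distrib, Equiv.sum_comp σ r] at h1
  rcases Int.units_eq_one_or (Equiv.Perm.sign σ) with hs | hs
  · rw [hs, one_smul]; exact h1
  · rw [hs, Units.neg_smul, one_smul]; exact neg_mem h1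

variable {K : Type*} [Field K]

lemma mem_hcomp {r : ℕ} {z : ℤ} {q : MvPolynomial (Fin r) K} :
    q ∈ hcomp K r z ↔ ∀ e ∈ q.support, (e.degree : ℤ) = z := by
  unfold hcomp
  split_ifs with h
  · rw [mem_homogeneousSubmodule]
    constructor
    · intro hq e he
      have : e.degree = z.toNat := by
        by_contra hne
        exact mem_support_iff.mp he (hq.coeff_eq_zero hne)
      omega
    · intro hq
      rw [← mem_homogeneousSubmodule, homogeneousSubmodule_eq_finsupp_supported,
        AddMonoidAlgebra.mem_supported]
      intro e he
      have := hq e he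
      simp only [Set.mem_ofPred_eq]
      omega
  · constructor
    · intro hq; simp [(Submodule.mem_bot K).mp hq]
    · intro hq
      rw [Submodule.mem_bot, ← support_eq_empty, Finset.eq_empty_iff_forall_notMem]
      intro e he
      have := hq e he
      omega

lemma mem_hcomp_of_isHomogeneous {r : ℕ} {k : ℕ} {z : ℤ} {q : MvPolynomial (Fin r) K}
    (hq : q.IsHomogeneous k) (h : z = k) : q ∈ hcomp K r z := by
  subst h
  simpa [hcomp] using hq

lemma hcomp_eq_zero_of_neg {r : ℕ} {z : ℤ} {q : MvPolynomial (Fin r) K}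
    (hq : q ∈ hcomp K r z) (hz : z < 0) : q = 0 := by
  simpa [hcomp, not_le.mpr hz] using hq

instance hcompGraded (r : ℕ) : SetLike.GradedMonoid (hcomp K r) where
  one_mem := mem_hcomp_of_isHomogeneous (isHomogeneous_one _ _) rfl
  mul_mem := by
    intro i j p q hp hq
    by_cases hi : 0 ≤ i
    · by_cases hj : 0 ≤ j
      · have hp' : p.IsHomogeneous i.toNat := by simpa [hcomp, hi] using hp
        have hq' : q.IsHomogeneous j.toNat := by simpa [hcomp, hj] using hq
        exact mem_hcomp_of_isHomogeneous (hp'.mul hq') (by push_cast; omega)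
      · rw [hcomp_eq_zero_of_neg hq (not_le.mp hj), mul_zero]
        exact zero_mem _
    · rw [hcomp_eq_zero_of_neg hp (not_le.mp hi), zero_mul]
      exact zero_mem _

lemma hcomp_mul_mem {r : ℕ} {i j k : ℤ} {p q : MvPolynomial (Fin r) K} (hp : p ∈ hcomp K r i)
    (hq : q ∈ hcomp K r j) (h : i + j = k) : p * q ∈ hcomp K r k :=
  h ▸ SetLike.mul_mem_graded hp hq

/-- The projection onto the component of degree `z`. -/
noncomputable def compZ (K : Type*) [Field K] (r : ℕ) (z : ℤ) :
    MvPolynomial (Fin r) K →ₗ[K] MvPolynomial (Fin r) K :=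
  if 0 ≤ z then homogeneousComponent z.toNat else 0

lemma compZ_mem (r : ℕ) (z : ℤ) (q : MvPolynomial (Fin r) K) : compZ K r z q ∈ hcomp K r z := by
  unfold compZ hcomp
  split_ifs with h
  · exact homogeneousComponent_mem _ _
  · simp

lemma compZ_of_mem {r : ℕ} {z w : ℤ} {q : MvPolynomial (Fin r) K} (hq : q ∈ hcomp K r w) :
    compZ K r z q = if w = z then q else 0 := by
  by_cases hw : 0 ≤ w
  · have hq' : q ∈ homogeneousSubmodule (Fin r) K w.toNat := by simpa [hcomp, hw] using hq
    unfold compZ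
    by_cases hz : 0 ≤ z
    · rw [if_pos hz, homogeneousComponent_of_mem hq']
      congr 1
      apply propext
      omega
    · rw [if_neg hz, if_neg (by omega)]; rfl
  · rw [hcomp_eq_zero_of_neg hq (not_le.mp hw)]; simp

lemma compZ_mul {r : ℕ} {w : ℤ} {q : MvPolynomial (Fin r) K} (hq : q ∈ hcomp K r w) (z : ℤ)
    (f : MvPolynomial (Fin r) K) : compZ K r z (q * f) = q * compZ K r (z - w) f := by
  induction f using MvPolynomial.induction_on' with
  | monomial e c =>
    have he : monomial e c ∈ hcomp K r e.degree :=
      mem_hcomp_of_isHomogeneous (isHomogeneous_monomial c rfl) rfl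
    rw [compZ_of_mem (hcomp_mul_mem hq he rfl), compZ_of_mem he]
    by_cases h : w + e.degree = z
    · rw [if_pos h, if_pos (by omega)]
    · rw [if_neg h, if_neg (by omega), mul_zero]
  | add p q hp hq => rw [mul_add, map_add, hp, hq, map_add, mul_add]

lemma exists_homogeneous_preimage {r : ℕ} {M J : Type*} [Fintype J]
    {φ : Matrix M J (MvPolynomial (Fin r) K)} {a : M → ℤ} {b : J → ℤ}
    (hφ : ∀ i j, φ i j ∈ hcomp K r (b j - a i)) {t : ℤ} {f : J → MvPolynomial (Fin r) K}
    (hg : ∀ i, (φ *ᵥ f) i ∈ hcomp K r (t - a i)) :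
    ∃ f' : J → MvPolynomial (Fin r) K, (∀ j, f' j ∈ hcomp K r (t - b j)) ∧ φ *ᵥ f' = φ *ᵥ f := by
  refine ⟨fun j => compZ K r (t - b j) (f j), fun j => compZ_mem _ _ _, ?_⟩
  ext1 i
  have h := compZ_of_mem (z := t - a i) (hg i)
  rw [if_pos rfl] at h
  rw [← h]
  simp only [mulVec, dotProduct, map_sum]
  refine Finset.sum_congr rfl fun j _ => ?_
  rw [compZ_mul (hφ i j)]
  congr 3
  ring

lemma mulVec_mem_hcomp {r : ℕ} {M J : Type*} [Fintype J]
    {φ : Matrix M J (MvPolynomial (Fin r) K)} {a : M → ℤ} {b : J → ℤ}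
    (hφ : ∀ i j, φ i j ∈ hcomp K r (b j - a i)) {t : ℤ} {f : J → MvPolynomial (Fin r) K}
    (hf : ∀ j, f j ∈ hcomp K r (t - b j)) (i : M) : (φ *ᵥ f) i ∈ hcomp K r (t - a i) :=
  sum_mem fun j _ => hcomp_mul_mem (hφ i j) (hf j) (by ring)

variable {N : Type*} [Fintype N] [DecidableEq N]
  {φ : Matrix N (Fin 2 ⊕ N) (MvPolynomial (Fin 3) K)} {a : N → ℤ} {b : Fin 2 ⊕ N → ℤ}

/-- There are no syzygies in degrees below those of the Cramer syzygies. -/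
lemma eq_zero_of_mulVec_eq_zero (hφ : ∀ i j, φ i j ∈ hcomp K 3 (b j - a i)) {M : ℕ}
    (hI : ∀ i, X i ^ M ∈ minorIdeal φ) {p : ℤ} (hp : ∀ j, p < (∑ j, b j) - (∑ i, a i) - b j)
    {u : Fin 2 ⊕ N → MvPolynomial (Fin 3) K} (hdeg : ∀ j, u j ∈ hcomp K 3 (p - b j))
    (hu : φ *ᵥ u = 0) : u = 0 := by
  obtain ⟨lam, hlam⟩ := mem_range_cram hI hu
  set C : Matrix (Fin 2 ⊕ N) (Fin 2 ⊕ N) (MvPolynomial (Fin 3) K) :=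
    of fun k j => stackDet φ (Pi.single k 1) (Pi.single j 1) with hC
  have hCmem : ∀ k j, C k j ∈ hcomp K 3 ((∑ j, b j) - (∑ i, a i) - b j - b k) := by
    intro k j
    have hs : ∀ l m : Fin 2 ⊕ N, (Pi.single l 1 : Fin 2 ⊕ N → MvPolynomial (Fin 3) K) m ∈
        hcomp K 3 (b m - b l) := by
      intro l m
      by_cases h : m = l
      · subst h
        simpa using SetLike.GradedOne.one_mem (A := hcomp K 3)
      · simp [Pi.single_eq_of_ne h]
    have := det_mem_graded (hcomp K 3)
      (fromRows (of ![Pi.single k 1, Pi.single j 1]) φ) (Sum.elim ![b k, b j] a) b (by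
        rintro (i | i) m
        · fin_cases i
          · exact hs k m
          · exact hs j m
        · exact hφ i m)
    change stackDet φ _ _ ∈ _
    unfold stackDet
    convert this using 2
    simp [Fintype.sum_sum_type]
    ring
  have hCl : C *ᵥ lam = u := by
    rw [← hlam]
    ext1 k
    rw [cram_apply, ← stackForm_apply]
    conv_rhs => rw [eq_sum_smul_single lam, map_sum]
    simp only [map_smul, mulVec, dotProduct, stackForm_apply, smul_eq_mul]
    exact Finset.sum_congr rfl fun j _ => mul_comm _ _
  obtain ⟨f, hf, hfu⟩ := exists_homogeneous_preimage hCmem (t := p) (f := lam)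
    (by rw [hCl]; exact hdeg)
  have : f = 0 := funext fun j => hcomp_eq_zero_of_neg (hf j) (by linarith [hp j])
  rw [← hCl, ← hfu, this, mulVec_zero]

end Graded

/-! ### Restriction to lines -/

section Lines

variable {A : Type*} [CommRing A]

/-- Polynomials of degree at most `k`, for `k : ℤ`. -/
def Fil (A : Type*) [CommRing A] (k : ℤ) : Submodule A (Polynomial A) where
  carrier := {q | ∀ i : ℕ, k < i → q.coeff i = 0}
  add_mem' := fun hp hq i hi => by rw [Polynomial.coeff_add, hp i hi, hq i hi, add_zero]
  zero_mem' := fun i _ => Polynomial.coeff_zero i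
  smul_mem' := fun c q hq i hi => by rw [Polynomial.coeff_smul, hq i hi, smul_zero]

lemma Fil_mono {k l : ℤ} (h : k ≤ l) : Fil A k ≤ Fil A l :=
  fun _ hq i hi => hq i (h.trans_lt hi)

lemma eq_zero_of_mem_Fil {k : ℤ} {q : Polynomial A} (hq : q ∈ Fil A k) (hk : k < 0) : q = 0 :=
  Polynomial.ext fun i => by rw [hq i (by omega), Polynomial.coeff_zero]

lemma C_mem_Fil (c : A) : Polynomial.C c ∈ Fil A 0 := fun i hi => by
  rw [Polynomial.coeff_C, if_neg (by omega)]

lemma X_mem_Fil : (Polynomial.X : Polynomial A) ∈ Fil A 1 := fun i hi => by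
  rw [Polynomial.coeff_X, if_neg (by omega)]

instance filGraded : SetLike.GradedMonoid (Fil A) where
  one_mem := by simpa using C_mem_Fil (1 : A)
  mul_mem := by
    intro i j p q hp hq n hn
    rw [Polynomial.coeff_mul]
    refine Finset.sum_eq_zero fun x hx => ?_
    rw [Finset.HasAntidiagonal.mem_antidiagonal] at hx
    by_cases h : i < x.1
    · rw [hp _ h, zero_mul]
    · rw [hq _ (by omega), mul_zero]

lemma Fil_mul_mem {i j k : ℤ} {p q : Polynomial A} (hp : p ∈ Fil A i) (hq : q ∈ Fil A j)
    (h : i + j = k) : p * q ∈ Fil A k :=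
  h ▸ SetLike.mul_mem_graded hp hq

lemma mulVec_mem_Fil {M J : Type*} [Fintype J] {φ : Matrix M J (Polynomial A)} {a : M → ℤ}
    {b : J → ℤ} (hφ : ∀ i j, φ i j ∈ Fil A (b j - a i)) {t : ℤ} {f : J → Polynomial A}
    (hf : ∀ j, f j ∈ Fil A (t - b j)) (i : M) : (φ *ᵥ f) i ∈ Fil A (t - a i) :=
  sum_mem fun j _ => Fil_mul_mem (hφ i j) (hf j) (by ring)

variable {K : Type*} [Field K] [Algebra K A]

/-- Restriction to the line `z = α x + β y`, dehomogenized by `x = 1`. -/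
noncomputable def lineMap (K : Type*) [Field K] [Algebra K A] (α β : A) :
    MvPolynomial (Fin 3) K →ₐ[K] Polynomial A :=
  aeval ![1, Polynomial.X, Polynomial.C α + Polynomial.C β * Polynomial.X]

lemma lineMap_X_zero (α β : A) : lineMap K α β (X 0) = 1 := by simp [lineMap]

lemma lineMap_X_one (α β : A) : lineMap K α β (X 1) = Polynomial.X := by simp [lineMap]

lemma lineMap_X_two (α β : A) :
    lineMap K α β (X 2) = Polynomial.C α + Polynomial.C β * Polynomial.X := by simp [lineMap]

lemma lineMap_mem_Fil (α β : A) {z : ℤ} {q : MvPolynomial (Fin 3) K} (hq : q ∈ hcomp K 3 z) :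
    lineMap K α β q ∈ Fil A z := by
  rw [lineMap, aeval_def, eval₂_eq']
  refine sum_mem fun e he => ?_
  have h1 : ∀ i : Fin 3, (![1, Polynomial.X, Polynomial.C α + Polynomial.C β * Polynomial.X] :
      Fin 3 → Polynomial A) i ∈ Fil A 1 := by
    intro i
    fin_cases i
    · exact Fil_mono zero_le_one SetLike.GradedOne.one_mem
    · exact X_mem_Fil
    · exact add_mem (Fil_mono zero_le_one (C_mem_Fil α))
        (Fil_mul_mem (C_mem_Fil β) X_mem_Fil (zero_add 1))
  have h2 := SetLike.prod_pow_mem_graded (Fil A) (fun _ => 1)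
    (![1, Polynomial.X, Polynomial.C α + Polynomial.C β * Polynomial.X] :
      Fin 3 → Polynomial A) (F := Finset.univ) (fun i => e i) (fun i _ => h1 i)
  have h3 : (∑ i : Fin 3, e i • (1 : ℤ)) = z := by
    rw [← mem_hcomp.mp hq e he, Finsupp.degree_eq_sum]
    simp
  rw [h3] at h2
  have h4 : algebraMap K (Polynomial A) (coeff e q) ∈ Fil A 0 := by
    rw [Polynomial.algebraMap_apply]
    exact C_mem_Fil _
  exact Fil_mul_mem h4 h2 (zero_add z)

variable {N : Type*} [Fintype N] [DecidableEq N]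
  {φ : Matrix N (Fin 2 ⊕ N) (MvPolynomial (Fin 3) K)} {a : N → ℤ} {b : Fin 2 ⊕ N → ℤ}

lemma minor_mem_hcomp (hφ : ∀ i j, φ i j ∈ hcomp K 3 (b j - a i)) (g : N → Fin 2 ⊕ N) :
    (φ.submatrix id g).det ∈ hcomp K 3 ((∑ i, b (g i)) - ∑ i, a i) :=
  det_mem_graded (hcomp K 3) _ a (fun i => b (g i)) fun i j => hφ i (g j)

lemma exists_homogeneous_combination (hφ : ∀ i j, φ i j ∈ hcomp K 3 (b j - a i))
    {q : MvPolynomial (Fin 3) K} {z : ℤ} (hq : q ∈ minorIdeal φ) (hz : q ∈ hcomp K 3 z) :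
    ∃ c : (N → Fin 2 ⊕ N) → MvPolynomial (Fin 3) K,
      (∀ g, c g ∈ hcomp K 3 (z - ((∑ i, b (g i)) - ∑ i, a i))) ∧
      ∑ g, c g * (φ.submatrix id g).det = q := by
  obtain ⟨c, hc⟩ := Ideal.mem_span_range_iff_exists_fun.mp hq
  obtain ⟨c', hc', h⟩ := exists_homogeneous_preimage (M := Unit)
    (φ := of fun _ g => (φ.submatrix id g).det) (a := fun _ => 0)
    (b := fun g => (∑ i, b (g i)) - ∑ i, a i) (t := z) (f := c)
    (fun _ g => by simpa using minor_mem_hcomp hφ g)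
    (fun _ => by
      simp only [mulVec, dotProduct, of_apply, sub_zero]
      simp_rw [mul_comm _ (c _)]
      rwa [hc])
  refine ⟨c', hc', ?_⟩
  have := congrFun h ()
  simp only [mulVec, dotProduct, of_apply] at this
  simp_rw [mul_comm _ (c _)] at this
  rw [← hc, ← this]
  exact Finset.sum_congr rfl fun g _ => mul_comm _ _

/-- Two syzygies on a line whose degrees add up to less than `d` are parallel. -/
lemma syzygy_parallel [IsDomain A] (hφ : ∀ i j, φ i j ∈ hcomp K 3 (b j - a i)) {M : ℕ}
    (hI : ∀ i, X i ^ M ∈ minorIdeal φ) (α β : A) {p q : ℤ}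
    (hpq : p + q < (∑ j, b j) - ∑ i, a i) {u w : Fin 2 ⊕ N → Polynomial A}
    (hu : ∀ j, u j ∈ Fil A (p - b j)) (hw : ∀ j, w j ∈ Fil A (q - b j))
    (hφu : φ.map (lineMap K α β) *ᵥ u = 0) (hφw : φ.map (lineMap K α β) *ᵥ w = 0)
    (j k : Fin 2 ⊕ N) : u j * w k = u k * w j := by
  obtain ⟨ψ, hψ⟩ : ∃ ψ, ψ = lineMap K α β := ⟨_, rfl⟩
  rw [← hψ] at hφu hφw
  obtain ⟨φ', hφ'⟩ : ∃ φ', φ' = φ.map ψ := ⟨_, rfl⟩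
  rw [← hφ'] at hφu hφw
  have hdet : ∀ g, ψ (φ.submatrix id g).det = (φ'.submatrix id g).det := fun g => by
    rw [AlgHom.map_det, hφ']; rfl
  let B : (N → Fin 2 ⊕ N) → Polynomial A := fun g => (fromCols (of ![u, w])ᵀ (sel g)).det
  have hBmem : ∀ g, B g ∈ Fil A (p + q + (∑ i, b (g i)) - ∑ j, b j) := by
    intro g
    have := det_mem_graded (Fil A) (fromCols (of ![u, w])ᵀ (sel g)) b
      (Sum.elim ![p, q] fun i => b (g i)) (by
        rintro m (i | i)
        · fin_cases i
          · exact hu m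
          · exact hw m
        · simp only [fromCols_apply_inr, sel, submatrix_apply, one_apply, id, Sum.elim_inr]
          split_ifs with h
          · subst h
            rw [sub_self]
            exact SetLike.GradedOne.one_mem
          · exact zero_mem _)
    convert this using 2
    simp [Fintype.sum_sum_type]
  have key : ∀ lam mu g, stackDet φ' lam mu * B g =
      ((lam ⬝ᵥ u) * (mu ⬝ᵥ w) - (lam ⬝ᵥ w) * (mu ⬝ᵥ u)) * (φ'.submatrix id g).det := by
    intro lam mu g
    have := wedge_mul_minor φ' hφu hφw lam mu (sel g)
    rw [mul_sel] at this
    exact this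
  obtain ⟨c, hc⟩ := Ideal.mem_span_range_iff_exists_fun.mp (hI 0)
  obtain ⟨c', hc', hsum⟩ := exists_homogeneous_combination hφ (hI 1) (z := M)
    (mem_hcomp_of_isHomogeneous (isHomogeneous_X_pow _ _) rfl)
  apply_fun ψ at hc hsum
  rw [map_pow, hψ, lineMap_X_zero, ← hψ, one_pow, map_sum] at hc
  rw [map_pow, hψ, lineMap_X_one, ← hψ, map_sum] at hsum
  simp only [map_mul, hdet] at hc hsum
  have h1 : ∀ lam mu, stackDet φ' lam mu * ∑ g, ψ (c g) * B g =
      ((lam ⬝ᵥ u) * (mu ⬝ᵥ w) - (lam ⬝ᵥ w) * (mu ⬝ᵥ u)) := by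
    intro lam mu
    rw [← mul_one (_ - _), ← hc, Finset.mul_sum, Finset.mul_sum]
    refine Finset.sum_congr rfl fun g _ => ?_
    linear_combination ψ (c g) * key lam mu g
  have h2 : ∀ lam mu, stackDet φ' lam mu * ∑ g, ψ (c' g) * B g =
      ((lam ⬝ᵥ u) * (mu ⬝ᵥ w) - (lam ⬝ᵥ w) * (mu ⬝ᵥ u)) * Polynomial.X ^ M := by
    intro lam mu
    rw [← hsum, Finset.mul_sum, Finset.mul_sum]
    refine Finset.sum_congr rfl fun g _ => ?_
    linear_combination ψ (c' g) * key lam mu g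
  have hone : (1 : Polynomial A) ∈ minorIdeal φ' :=
    Ideal.mem_span_range_iff_exists_fun.mpr ⟨_, hc⟩
  obtain ⟨j₀, k₀, h0⟩ := exists_stackDet_ne_zero φ' hone one_ne_zero
  have h3 : (∑ g, ψ (c g) * B g) * Polynomial.X ^ M = ∑ g, ψ (c' g) * B g := by
    refine mul_left_cancel₀ h0 ?_
    rw [h2, ← h1]
    ring
  have h4 : ∑ g, ψ (c g) * B g = 0 := by
    have h5 : (∑ g, ψ (c g) * B g) * Polynomial.X ^ M ∈
        Fil A (M + (p + q - ((∑ j, b j) - ∑ i, a i))) := by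
      rw [h3]
      exact sum_mem fun g _ => Fil_mul_mem (hψ ▸ lineMap_mem_Fil α β (hc' g)) (hBmem g) (by ring)
    ext i
    rw [Polynomial.coeff_zero, ← Polynomial.coeff_mul_X_pow _ M]
    exact h5 _ (by push_cast; omega)
  have := h1 (Pi.single j 1) (Pi.single k 1)
  rw [h4, mul_zero] at this
  simp only [single_one_dotProduct] at this
  linear_combination -this

end Lines

/-! ### Dehomogenization -/

section Dehomogenize

variable {K : Type*} [Field K]

/-- Dehomogenization by `x = 1`. -/
noncomputable def dehom (K : Type*) [Field K] :
    MvPolynomial (Fin 3) K →ₐ[K] MvPolynomial (Fin 2) K :=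
  aeval ![1, X 1, X 0]

lemma eq_zero_of_dehom_eq_zero {z : ℤ} {q : MvPolynomial (Fin 3) K} (hq : q ∈ hcomp K 3 z)
    (h : dehom K q = 0) : q = 0 := by
  by_contra hne
  obtain ⟨e, he⟩ := ne_zero_iff.mp hne
  let s : (Fin 3 →₀ ℕ) → (Fin 2 →₀ ℕ) := fun e => Finsupp.single 0 (e 2) + Finsupp.single 1 (e 1)
  have h1 : dehom K q = ∑ e ∈ q.support, monomial (s e) (coeff e q) := by
    rw [dehom, aeval_def, eval₂_eq']
    refine Finset.sum_congr rfl fun e _ => ?_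
    rw [Fin.prod_univ_three, monomial_eq, algebraMap_eq]
    simp [s, Finsupp.prod_fintype, mul_comm]
  have h2 := congrArg (coeff (s e)) h1
  rw [h, coeff_zero, coeff_sum, Finset.sum_eq_single e] at h2
  · rw [coeff_monomial, if_pos rfl] at h2
    exact he h2.symm
  · intro e' he' hee
    rw [coeff_monomial, if_neg]
    intro hs
    apply hee
    have hs0 := DFunLike.congr_fun hs 0
    have hs1 := DFunLike.congr_fun hs 1
    have hd := (mem_hcomp.mp hq e' he').trans (mem_hcomp.mp hq e (mem_support_iff.mpr he)).symm
    simp only [Finsupp.degree_eq_sum, Fin.sum_univ_three] at hd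
    simp [s] at hs0 hs1
    ext i
    fin_cases i <;> simp <;> omega
  · intro h3
    exact absurd (mem_support_iff.mpr he) h3

lemma exists_dehom_eq {z : ℤ} {q : MvPolynomial (Fin 2) K}
    (hq : ∀ e ∈ q.support, ((e 0 + e 1 : ℕ) : ℤ) ≤ z) : ∃ f ∈ hcomp K 3 z, dehom K f = q := by
  refine ⟨∑ e ∈ q.support, C (coeff e q) *
    (X 0 ^ (z.toNat - (e 0 + e 1)) * X 1 ^ (e 1) * X 2 ^ (e 0)), sum_mem fun e he => ?_, ?_⟩
  · have := hq e he
    refine mem_hcomp_of_isHomogeneous ((isHomogeneous_C _ _).mul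
      (((isHomogeneous_X_pow _ _).mul (isHomogeneous_X_pow _ _)).mul (isHomogeneous_X_pow _ _))) ?_
    push_cast
    omega
  · conv_rhs => rw [← support_sum_monomial_coeff q]
    rw [map_sum]
    refine Finset.sum_congr rfl fun e _ => ?_
    rw [monomial_eq]
    simp [dehom, Finsupp.prod_fintype, mul_comm]

end Dehomogenize

/-! ### Syzygies on the generic line -/

section GenericLine

variable {K : Type*} [Field K]

/-- A derivation applied to the coefficients of a polynomial. -/
noncomputable def coeffDeriv {A : Type*} [CommRing A] [Algebra K A] (d : Derivation K A A) :
    Derivation K (Polynomial A) (Polynomial A) :=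
  PolynomialModule.equivPolynomialSelf.toLinearMap.compDer d.mapCoeffs

lemma coeff_coeffDeriv {A : Type*} [CommRing A] [Algebra K A] (d : Derivation K A A)
    (q : Polynomial A) (i : ℕ) : (coeffDeriv d q).coeff i = d (q.coeff i) := rfl

/-- The derivation `s ∂/∂α - ∂/∂β` of `K[α, β][s]`. -/
noncomputable def lineDeriv (K : Type*) [Field K] :
    Derivation K (Polynomial (MvPolynomial (Fin 2) K)) (Polynomial (MvPolynomial (Fin 2) K)) :=
  (Polynomial.X : Polynomial (MvPolynomial (Fin 2) K)) • coeffDeriv (pderiv 0) -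
    coeffDeriv (pderiv 1)

lemma coeff_lineDeriv_zero (q : Polynomial (MvPolynomial (Fin 2) K)) :
    (lineDeriv K q).coeff 0 = - pderiv 1 (q.coeff 0) := by
  simp [lineDeriv, coeff_coeffDeriv]

lemma coeff_lineDeriv_succ (q : Polynomial (MvPolynomial (Fin 2) K)) (i : ℕ) :
    (lineDeriv K q).coeff (i + 1) = pderiv 0 (q.coeff i) - pderiv 1 (q.coeff (i + 1)) := by
  simp [lineDeriv, coeff_coeffDeriv]

lemma lineDeriv_mem_Fil {q : Polynomial (MvPolynomial (Fin 2) K)} {k : ℤ}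
    (hq : q ∈ Fil _ k) : lineDeriv K q ∈ Fil _ (k + 1) := by
  intro i hi
  cases i with
  | zero => rw [coeff_lineDeriv_zero, hq 0 (by push_cast at hi ⊢; omega), map_zero, neg_zero]
  | succ i =>
    rw [coeff_lineDeriv_succ, hq i (by push_cast at hi; omega),
      hq (i + 1) (by push_cast at hi ⊢; omega), map_zero, map_zero, sub_zero]

lemma lineDeriv_X : lineDeriv K Polynomial.X = 0 := by
  ext1 i
  rcases i with _ | _ | i
  · simp [coeff_lineDeriv_zero]
  · simp [coeff_lineDeriv_succ, Polynomial.coeff_X]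
  · rw [coeff_lineDeriv_succ]
    simp only [Polynomial.coeff_X]
    split_ifs <;> simp

lemma lineDeriv_C_add : lineDeriv K (Polynomial.C (X 0) + Polynomial.C (X 1) * Polynomial.X) = 0 := by
  ext1 i
  rcases i with _ | _ | i
  · rw [coeff_lineDeriv_zero]
    simp [pderiv_X]
  · rw [coeff_lineDeriv_succ]
    simp [Polynomial.coeff_X, Polynomial.coeff_C, pderiv_X]
  · rw [coeff_lineDeriv_succ]
    simp only [Polynomial.coeff_add, Polynomial.coeff_C_mul, Polynomial.coeff_X,
      Polynomial.coeff_C]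
    split_ifs <;> first | contradiction | omega | simp

lemma lineDeriv_lineMap (q : MvPolynomial (Fin 3) K) :
    lineDeriv K (lineMap K (X 0 : MvPolynomial (Fin 2) K) (X 1) q) = 0 := by
  induction q using MvPolynomial.induction_on with
  | C c => rw [← algebraMap_eq, AlgHom.commutes, Derivation.map_algebraMap]
  | add p q hp hq => rw [map_add, map_add, hp, hq, add_zero]
  | mul_X p i hp =>
    rw [map_mul, Derivation.leibniz, hp, smul_zero, add_zero]
    fin_cases i
    · change _ • lineDeriv K (lineMap K _ _ (X 0)) = 0
      rw [lineMap_X_zero, Derivation.map_one_eq_zero, smul_zero]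
    · change _ • lineDeriv K (lineMap K _ _ (X 1)) = 0
      rw [lineMap_X_one, lineDeriv_X, smul_zero]
    · change _ • lineDeriv K (lineMap K _ _ (X 2)) = 0
      rw [lineMap_X_two, lineDeriv_C_add, smul_zero]

lemma eq_zero_of_pderiv_eq_mul {σ : Type*} {i : σ} {g q : MvPolynomial σ K} (hq : q ≠ 0)
    (h : pderiv i q = g * q) : g = 0 := by
  by_contra hg
  have h0 : pderiv i q ≠ 0 := h ▸ mul_ne_zero hg hq
  have h1 : (pderiv i q).totalDegree < q.totalDegree := by
    obtain ⟨e, he, hdeg⟩ := Finset.exists_mem_eq_sup _ (support_nonempty.mpr h0)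
      fun s : σ →₀ ℕ => s.sum fun _ e => e
    have h2 : e + Finsupp.single i 1 ∈ q.support := by
      rw [mem_support_iff, coeff_pderiv] at he
      exact mem_support_iff.mpr (left_ne_zero_of_mul he)
    have h3 := le_totalDegree h2
    rw [Finsupp.sum_add_index' (fun _ => rfl) (fun _ _ _ => rfl),
      Finsupp.sum_single_index rfl] at h3
    rw [totalDegree, hdeg]
    omega
  rw [h, totalDegree_mul_of_isDomain hg hq] at h1
  omega

lemma eq_zero_of_lineDeriv_eq_mul {f q : Polynomial (MvPolynomial (Fin 2) K)} (hq : q ≠ 0)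
    (h : lineDeriv K q = f * q) : f = 0 := by
  have hfdeg : f.natDegree ≤ 1 := by
    by_cases hf : f = 0
    · simp [hf]
    have h1 : q ∈ Fil _ (q.natDegree : ℤ) := fun i hi =>
      Polynomial.coeff_eq_zero_of_natDegree_lt (by exact_mod_cast hi)
    have h2 : (lineDeriv K q).natDegree ≤ q.natDegree + 1 :=
      Polynomial.natDegree_le_iff_coeff_eq_zero.mpr fun i hi =>
        lineDeriv_mem_Fil h1 i (by exact_mod_cast hi)
    rw [h, Polynomial.natDegree_mul hf hq] at h2
    omega
  have hf1 : f.coeff 1 = 0 := by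
    refine eq_zero_of_pderiv_eq_mul (i := 0) (Polynomial.leadingCoeff_ne_zero.mpr hq) ?_
    have := coeff_lineDeriv_succ q q.natDegree
    rw [Polynomial.coeff_eq_zero_of_natDegree_lt (Nat.lt_succ_self _), map_zero, sub_zero, h,
      add_comm, Polynomial.coeff_mul_add_eq_of_natDegree_le hfdeg le_rfl] at this
    exact this.symm
  have hf0 : f = Polynomial.C (f.coeff 0) := by
    ext1 i
    rcases i with _ | _ | i
    · simp
    · simp [hf1]
    · simp [Polynomial.coeff_eq_zero_of_natDegree_lt (show f.natDegree < i + 2 by omega)]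
  suffices h0 : -f.coeff 0 = 0 by rw [hf0, neg_eq_zero.mp h0, map_zero]
  refine eq_zero_of_pderiv_eq_mul (i := 1) (Polynomial.trailingCoeff_nonzero_iff_nonzero.mpr hq) ?_
  have h3 : (lineDeriv K q).coeff q.natTrailingDegree = (f * q).coeff q.natTrailingDegree := by
    rw [h]
  rw [hf0, Polynomial.coeff_C_mul] at h3
  unfold Polynomial.trailingCoeff
  rcases hm : q.natTrailingDegree with _ | m
  · rw [hm, coeff_lineDeriv_zero] at h3
    linear_combination -h3
  · rw [hm, coeff_lineDeriv_succ,
      Polynomial.coeff_eq_zero_of_lt_natTrailingDegree (p := q) (n := m) (by omega), map_zero] at h3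
    linear_combination -h3

end GenericLine

section GenericSyzygies

variable {K : Type*} [Field K]

lemma mem_Fil_of_mul_mem {A : Type*} [CommRing A] [IsDomain A] {g q : Polynomial A} {k : ℤ}
    (hg : g ≠ 0) (h : g * q ∈ Fil A k) : q ∈ Fil A k := by
  by_cases hq : q = 0
  · rw [hq]; exact zero_mem _
  intro i hi
  refine Polynomial.coeff_eq_zero_of_natDegree_lt ?_
  have h1 : ((g * q).natDegree : ℤ) ≤ k := by
    by_contra hlt
    exact Polynomial.leadingCoeff_ne_zero.mpr (mul_ne_zero hg hq) (h _ (not_le.mp hlt))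
  rw [Polynomial.natDegree_mul hg hq] at h1
  omega

variable {N : Type*} [Fintype N] [DecidableEq N]
  {φ : Matrix N (Fin 2 ⊕ N) (MvPolynomial (Fin 3) K)} {a : N → ℤ} {b : Fin 2 ⊕ N → ℤ}

/-- A primitive syzygy of low degree on the generic line is killed by `lineDeriv`. -/
lemma lineDeriv_eq_zero (hφ : ∀ i j, φ i j ∈ hcomp K 3 (b j - a i)) {M : ℕ}
    (hI : ∀ i, X i ^ M ∈ minorIdeal φ) {p : ℤ} (hp : 2 * p + 1 < (∑ j, b j) - ∑ i, a i)
    {u : Fin 2 ⊕ N → Polynomial (MvPolynomial (Fin 2) K)}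
    (hu : ∀ j, u j ∈ Fil _ (p - b j)) (hφu : φ.map (lineMap K (X 0) (X 1)) *ᵥ u = 0)
    (hgcd : ∀ q f, (∀ k, q ∣ u k * f) → q ∣ f) (h0 : u ≠ 0) (j : Fin 2 ⊕ N) :
    lineDeriv K (u j) = 0 := by
  have hD : φ.map (lineMap K (X 0) (X 1)) *ᵥ (fun j => lineDeriv K (u j)) = 0 := by
    ext1 i
    have h1 := congrArg (lineDeriv K) (congrFun hφu i)
    simp only [mulVec, dotProduct, map_apply, map_sum, Derivation.leibniz, lineDeriv_lineMap,
      smul_eq_mul, Pi.zero_apply, map_zero] at h1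
    simpa [mulVec, dotProduct] using h1
  have hpar : ∀ j k, u j * lineDeriv K (u k) = u k * lineDeriv K (u j) :=
    syzygy_parallel hφ hI _ _ (p := p) (q := p + 1) (by linarith) hu
      (fun j => by have := lineDeriv_mem_Fil (hu j); rwa [sub_add_eq_add_sub] at this) hφu hD
  obtain ⟨l, hl⟩ := Function.ne_iff.mp h0
  obtain ⟨f, hf⟩ := hgcd (u l) (lineDeriv K (u l)) fun k => ⟨_, (hpar l k).symm⟩
  have hf0 : f = 0 := eq_zero_of_lineDeriv_eq_mul hl (by rw [hf, mul_comm])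
  have h2 := hpar l j
  rw [hf, hf0, mul_zero, mul_zero] at h2
  exact (mul_eq_zero.mp h2).resolve_left hl

/-- Setting `β = 0` in a polynomial in `s` over `K[α, β]`. -/
noncomputable def setBetaZero (K : Type*) [Field K] :
    Polynomial (MvPolynomial (Fin 2) K) →+* MvPolynomial (Fin 2) K :=
  Polynomial.eval₂RingHom (aeval ![X 0, 0] : MvPolynomial (Fin 2) K →ₐ[K] _).toRingHom (X 1)

lemma setBetaZero_lineMap (q : MvPolynomial (Fin 3) K) :
    setBetaZero K (lineMap K (X 0) (X 1) q) = dehom K q := by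
  induction q using MvPolynomial.induction_on with
  | C c => simp [setBetaZero, lineMap, dehom, Polynomial.algebraMap_apply]
  | add p q hp hq => rw [map_add, map_add, map_add, hp, hq]
  | mul_X p i hp =>
    rw [map_mul, map_mul, map_mul, hp]
    congr 1
    fin_cases i <;> simp [setBetaZero, lineMap, dehom]

lemma coeff_setBetaZero (q : Polynomial (MvPolynomial (Fin 2) K)) (m : Fin 2 →₀ ℕ) :
    coeff m (setBetaZero K q) = coeff (Finsupp.single 0 (m 0)) (q.coeff (m 1)) := by
  induction q using Polynomial.induction_on' with
  | add p q hp hq => rw [map_add, coeff_add, hp, hq, Polynomial.coeff_add, coeff_add]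
  | monomial n c =>
    induction c using MvPolynomial.induction_on' with
    | add p q hp hq =>
      rw [map_add, map_add, coeff_add, hp, hq, Polynomial.coeff_add, coeff_add]
    | monomial e c =>
      have h1 : setBetaZero K (Polynomial.monomial n (monomial e c)) =
          if e 1 = 0 then monomial (Finsupp.single 0 (e 0) + Finsupp.single 1 n) c else 0 := by
        have : aeval (![X 0, 0] : Fin 2 → MvPolynomial (Fin 2) K) (monomial e c) =
            C c * (X 0 ^ e 0 * 0 ^ e 1) := by
          rw [aeval_monomial]
          simp [Finsupp.prod_fintype, algebraMap_eq]
        simp only [setBetaZero, Polynomial.coe_eval₂RingHom, Polynomial.eval₂_monomial,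
          AlgHom.toRingHom_eq_coe, RingHom.coe_coe, this]
        split_ifs with h
        · rw [h, monomial_eq]
          simp [Finsupp.prod_fintype, mul_assoc]
        · simp [h]
      rw [h1, Polynomial.coeff_monomial]
      split_ifs with h2 h3 h3
      · rw [coeff_monomial, coeff_monomial]
        congr 1
        simp only [eq_iff_iff, Finsupp.ext_iff, Fin.forall_fin_two]
        simp [h2, h3]
      · rw [coeff_monomial, if_neg, coeff_zero]
        intro h; apply h3
        simpa using DFunLike.congr_fun h 1
      · rw [coeff_zero, coeff_monomial, if_neg]
        intro h; apply h2
        simpa using DFunLike.congr_fun h 1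
      · simp

lemma coeff_succ_of_lineDeriv_eq_zero {q : Polynomial (MvPolynomial (Fin 2) K)}
    (h : lineDeriv K q = 0) (i : ℕ) (e : Fin 2 →₀ ℕ) :
    coeff (e + Finsupp.single 1 1) (q.coeff (i + 1)) * (e 1 + 1) =
      coeff (e + Finsupp.single 0 1) (q.coeff i) * (e 0 + 1) := by
  have h1 := congrArg (fun r => coeff e (Polynomial.coeff r (i + 1))) h
  simp only [coeff_lineDeriv_succ, Polynomial.coeff_zero, coeff_sub, coeff_pderiv, coeff_zero]
    at h1
  linear_combination -h1

variable [CharZero K]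

/-- A polynomial killed by `lineDeriv` is determined by its restriction to `β = 0`. -/
lemma eq_zero_of_setBetaZero {q : Polynomial (MvPolynomial (Fin 2) K)}
    (h : lineDeriv K q = 0) (h0 : setBetaZero K q = 0) : q = 0 := by
  have key : ∀ l i k, coeff (Finsupp.single 0 k + Finsupp.single 1 l) (q.coeff i) = 0 := by
    intro l
    induction l with
    | zero =>
      intro i k
      have := congrArg (coeff (Finsupp.single 0 k + Finsupp.single 1 i)) h0
      rw [coeff_setBetaZero] at this
      simpa using this
    | succ l ih =>
      intro i k
      have hl : ((l : K) + 1) ≠ 0 := Nat.cast_add_one_ne_zero l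
      refine (mul_eq_zero.mp ?_).resolve_right hl
      cases i with
      | zero =>
        have h1 := congrArg (fun r => coeff (Finsupp.single 0 k + Finsupp.single 1 l)
          (Polynomial.coeff r 0)) h
        simp only [coeff_lineDeriv_zero, Polynomial.coeff_zero, coeff_neg, coeff_pderiv,
          coeff_zero, neg_eq_zero] at h1
        rw [add_assoc, ← Finsupp.single_add] at h1
        simpa using h1
      | succ i =>
        have h1 := coeff_succ_of_lineDeriv_eq_zero h i (Finsupp.single 0 k + Finsupp.single 1 l)
        rw [add_right_comm _ _ (Finsupp.single 0 1), ← Finsupp.single_add, ih, zero_mul,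
          add_assoc, ← Finsupp.single_add] at h1
        simpa using h1
  ext i e
  have he : e = Finsupp.single 0 (e 0) + Finsupp.single 1 (e 1) := by
    ext m; fin_cases m <;> simp
  rw [he, key]
  simp

lemma degree_le_of_lineDeriv_eq_zero {q : Polynomial (MvPolynomial (Fin 2) K)}
    (h : lineDeriv K q = 0) {P : ℤ} (hq : q ∈ Fil _ P) {e : Fin 2 →₀ ℕ}
    (he : e ∈ (setBetaZero K q).support) : ((e 0 + e 1 : ℕ) : ℤ) ≤ P := by
  have key : ∀ k i l, coeff (Finsupp.single 0 k + Finsupp.single 1 l) (q.coeff i) ≠ 0 →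
      ((k + i : ℕ) : ℤ) ≤ P := by
    intro k
    induction k with
    | zero =>
      intro i l hne
      by_contra hlt
      rw [hq i (by push_cast at hlt; omega), coeff_zero] at hne
      exact hne rfl
    | succ k ih =>
      intro i l hne
      have h1 := coeff_succ_of_lineDeriv_eq_zero h i (Finsupp.single 0 k + Finsupp.single 1 l)
      rw [add_right_comm _ _ (Finsupp.single 0 1), ← Finsupp.single_add,
          add_assoc, ← Finsupp.single_add] at h1
      have h2 := ih (i + 1) (l + 1) (by
        intro h0
        rw [h0, zero_mul, eq_comm] at h1
        refine (mul_ne_zero hne ?_) h1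
        simpa using Nat.cast_add_one_ne_zero k)
      push_cast at h2 ⊢
      linarith
  rw [mem_support_iff, coeff_setBetaZero] at he
  exact key (e 0) (e 1) 0 (by simpa using he)

/-- There are no syzygies of low degree on the generic line. -/
lemma eq_zero_of_generic_syzygy (hφ : ∀ i j, φ i j ∈ hcomp K 3 (b j - a i)) {M : ℕ}
    (hI : ∀ i, X i ^ M ∈ minorIdeal φ) {p : ℤ} (hp : 2 * p + 1 < (∑ j, b j) - ∑ i, a i)
    (hpb : ∀ j, p < (∑ j, b j) - (∑ i, a i) - b j)
    {u : Fin 2 ⊕ N → Polynomial (MvPolynomial (Fin 2) K)}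
    (hu : ∀ j, u j ∈ Fil _ (p - b j)) (hφu : φ.map (lineMap K (X 0) (X 1)) *ᵥ u = 0) : u = 0 := by
  by_contra h0
  classical
  let : StrongNormalizationMonoid (Polynomial (MvPolynomial (Fin 2) K)) :=
    UniqueFactorizationMonoid.strongNormalizationMonoid
  let : NormalizedGCDMonoid (Polynomial (MvPolynomial (Fin 2) K)) :=
    UniqueFactorizationMonoid.toNormalizedGCDMonoid _
  obtain ⟨w, hw, hgcd⟩ := Finset.extract_gcd u Finset.univ_nonempty
  simp only [Finset.mem_univ, true_implies] at hw
  set g := Finset.univ.gcd u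
  have hg : g ≠ 0 := by
    intro hg
    apply h0
    ext1 j
    rw [hw j, hg, zero_mul]; rfl
  have hw0 : w ≠ 0 := by
    rintro rfl
    apply h0
    ext1 j
    rw [hw j, Pi.zero_apply, mul_zero]
  have hwF : ∀ j, w j ∈ Fil _ (p - b j) := fun j => mem_Fil_of_mul_mem hg (hw j ▸ hu j)
  have hφw : φ.map (lineMap K (X 0) (X 1)) *ᵥ w = 0 := by
    have h1 : u = g • w := funext hw
    rw [h1, mulVec_smul] at hφu
    exact (smul_eq_zero.mp hφu).resolve_left hg
  have hprim : ∀ q f, (∀ k, q ∣ w k * f) → q ∣ f := by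
    intro q f h
    have h1 := Finset.dvd_gcd (s := Finset.univ) (f := fun k => w k * f) fun k _ => h k
    have h2 := (Finset.gcd_mul_right' (s := Finset.univ) f (f := w))
    rw [hgcd, one_mul] at h2
    exact h1.trans h2.dvd
  have hD := lineDeriv_eq_zero hφ hI hp hwF hφw hprim hw0
  choose U hU hUw using fun j => exists_dehom_eq (z := p - b j) fun e he =>
    degree_le_of_lineDeriv_eq_zero (hD j) (hwF j) he
  have hφU : φ *ᵥ U = 0 := by
    ext1 i
    refine eq_zero_of_dehom_eq_zero (mulVec_mem_hcomp hφ hU i) ?_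
    have h1 := congrArg (setBetaZero K) (congrFun hφw i)
    simp only [mulVec, dotProduct, map_sum, map_mul, map_apply, setBetaZero_lineMap,
      Pi.zero_apply, map_zero, ← hUw] at h1 ⊢
    exact h1
  have hU0 := eq_zero_of_mulVec_eq_zero hφ hI hpb hU hφU
  refine hw0 (funext fun j => eq_zero_of_setBetaZero (hD j) ?_)
  rw [← hUw, hU0, Pi.zero_apply, map_zero]

end GenericSyzygies

/-! ### Specialization of the line -/

section Specialize

lemma exists_left_inverse_of_mulVec_eq_zero {F κ ι : Type*} [Field F] [Fintype κ] [Fintype ι]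
    [DecidableEq ι] (T : Matrix κ ι F) (h : ∀ v, T *ᵥ v = 0 → v = 0) :
    ∃ B : Matrix ι κ F, B * T = 1 := by
  classical
  obtain ⟨g, hg⟩ := T.mulVecLin.exists_leftInverse_of_injective
    (LinearMap.ker_eq_bot'.mpr fun v hv => h v hv)
  refine ⟨LinearMap.toMatrix' g, ?_⟩
  rw [← LinearMap.toMatrix'_toLin' T, ← LinearMap.toMatrix'_comp, toLin'_apply', hg,
    LinearMap.toMatrix'_id]

/-- An injective matrix over a domain has a left inverse up to a nonzero scalar. -/
lemma exists_mul_eq_smul_one {A κ ι : Type*} [CommRing A] [IsDomain A] [Fintype κ] [Fintype ι]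
    [DecidableEq ι] (T : Matrix κ ι A) (h : ∀ v, T *ᵥ v = 0 → v = 0) :
    ∃ (B : Matrix ι κ A) (g : A), g ≠ 0 ∧ B * T = g • (1 : Matrix ι ι A) := by
  let F := FractionRing A
  have hinj : Function.Injective (algebraMap A F) := IsFractionRing.injective A F
  obtain ⟨B, hB⟩ := exists_left_inverse_of_mulVec_eq_zero (T.map (algebraMap A F)) (by
    intro v hv
    obtain ⟨c, hc⟩ := IsLocalization.exist_integer_multiples_of_finite (nonZeroDivisors A) v
    choose w hw using hc
    have hc0 : algebraMap A F c ≠ 0 :=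
      (map_ne_zero_iff _ hinj).mpr (nonZeroDivisors.ne_zero c.2)
    have hw0 : w = 0 := by
      apply h
      ext1 i
      apply hinj
      have h1 := congrArg (fun x => algebraMap A F c * x) (congrFun hv i)
      simp only [mulVec, dotProduct, map_apply, Finset.mul_sum, Pi.zero_apply, mul_zero] at h1
      simp only [mulVec, dotProduct, map_sum, map_mul, hw, Pi.zero_apply, map_zero,
        Algebra.smul_def]
      rw [← h1]
      exact Finset.sum_congr rfl fun j _ => by ring
    ext1 j
    have h2 := hw j
    rw [hw0, Pi.zero_apply, map_zero, Algebra.smul_def] at h2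
    exact (mul_eq_zero.mp h2.symm).resolve_left hc0)
  obtain ⟨c, hc⟩ := IsLocalization.exist_integer_multiples_of_finite (nonZeroDivisors A)
    fun x : ι × κ => B x.1 x.2
  choose B' hB' using hc
  refine ⟨of fun i k => B' (i, k), c, nonZeroDivisors.ne_zero c.2, ?_⟩
  ext i j
  apply hinj
  have h1 : algebraMap A F c * (B * T.map (algebraMap A F)) i j =
      algebraMap A F c * (1 : Matrix ι ι F) i j := by rw [hB]
  simp only [Algebra.smul_def] at hB'
  simp only [mul_apply, map_apply] at h1
  simp only [mul_apply, of_apply, map_sum, map_mul, hB', Matrix.smul_apply, smul_eq_mul]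
  convert h1 using 1
  · rw [Finset.mul_sum]
    exact Finset.sum_congr rfl fun j _ => mul_assoc _ _ _
  · congr 1
    simp only [one_apply]
    split_ifs <;> simp

lemma exists_eval_injective {K σ κ ι : Type*} [Field K] [Infinite K] [Fintype κ] [Fintype ι]
    (T : Matrix κ ι (MvPolynomial σ K)) (h : ∀ v, T *ᵥ v = 0 → v = 0) :
    ∃ c : σ → K, ∀ v, T.map (eval c) *ᵥ v = 0 → v = 0 := by
  classical
  obtain ⟨B, g, hg, hBT⟩ := exists_mul_eq_smul_one T h
  obtain ⟨c, hc⟩ : ∃ c, eval c g ≠ 0 := by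
    by_contra! h0
    exact hg (MvPolynomial.funext fun x => by rw [h0, map_zero])
  refine ⟨c, fun v hv => ?_⟩
  have h1 : B.map (eval c) * T.map (eval c) = eval c g • (1 : Matrix ι ι K) := by
    rw [← Matrix.map_mul, hBT]
    ext i j
    simp only [map_apply, Matrix.smul_apply, smul_eq_mul, map_mul, one_apply]
    split_ifs <;> simp
  have h2 := congrArg (fun x => B.map (eval c) *ᵥ x) hv
  simp only [mulVec_mulVec, h1, mulVec_zero, smul_mulVec, one_mulVec] at h2
  exact (smul_eq_zero.mp h2).resolve_left hc

variable {N J : Type*}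

/-- The vector of polynomials with the given coefficients. -/
noncomputable def polyOfCoeffs {A : Type*} [CommRing A] (n : J → ℕ) (v : (Σ j, Fin (n j)) → A)
    (j : J) : Polynomial A :=
  ∑ k : Fin (n j), Polynomial.monomial k (v ⟨j, k⟩)

lemma coeff_polyOfCoeffs {A : Type*} [CommRing A] (n : J → ℕ) (v : (Σ j, Fin (n j)) → A) (j : J)
    (r : ℕ) : (polyOfCoeffs n v j).coeff r = if h : r < n j then v ⟨j, ⟨r, h⟩⟩ else 0 := by
  simp only [polyOfCoeffs, Polynomial.finsetSum_coeff, Polynomial.coeff_monomial]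
  split_ifs with h
  · rw [Finset.sum_eq_single ⟨r, h⟩]
    · simp
    · intro k _ hk
      rw [if_neg]
      intro hkr
      exact hk (Fin.ext hkr)
    · simp
  · refine Finset.sum_eq_zero fun k _ => if_neg ?_
    intro hkr
    have := k.2
    omega

/-- The matrix of multiplication by `φ` on coefficients of bounded degree. -/
noncomputable def coeffMatrix {A : Type*} [CommRing A] (φ : Matrix N J (Polynomial A))
    (m : N → ℕ) (n : J → ℕ) : Matrix (Σ i, Fin (m i)) (Σ j, Fin (n j)) A :=
  of fun i j => (φ i.1 j.1 * Polynomial.X ^ (j.2 : ℕ)).coeff i.2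

lemma coeffMatrix_mulVec [Fintype J] {A : Type*} [CommRing A] (φ : Matrix N J (Polynomial A))
    (m : N → ℕ) (n : J → ℕ) (v : (Σ j, Fin (n j)) → A) (i : Σ i, Fin (m i)) :
    (coeffMatrix φ m n *ᵥ v) i = ((φ *ᵥ polyOfCoeffs n v) i.1).coeff i.2 := by
  simp only [mulVec, dotProduct, coeffMatrix, of_apply, Fintype.sum_sigma, polyOfCoeffs,
    Polynomial.finsetSum_coeff, Finset.mul_sum]
  refine Finset.sum_congr rfl fun j _ => Finset.sum_congr rfl fun k _ => ?_
  rw [← Polynomial.C_mul_X_pow_eq_monomial, mul_left_comm, Polynomial.coeff_C_mul, mul_comm]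

lemma polyOfCoeffs_mem_Fil {A : Type*} [CommRing A] (b : J → ℤ) (t : ℤ)
    (v : (Σ j, Fin (t - b j + 1).toNat) → A) (j : J) :
    polyOfCoeffs (fun j => (t - b j + 1).toNat) v j ∈ Fil A (t - b j) := by
  intro r hr
  rw [coeff_polyOfCoeffs, dif_neg (by omega)]

lemma polyOfCoeffs_coeff {A : Type*} [CommRing A] {b : J → ℤ} {t : ℤ} {u : J → Polynomial A}
    (hu : ∀ j, u j ∈ Fil A (t - b j)) :
    polyOfCoeffs (fun j => (t - b j + 1).toNat) (fun x => (u x.1).coeff x.2) = u := by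
  ext j r
  rw [coeff_polyOfCoeffs]
  split_ifs with hr
  · rfl
  · rw [hu j r (by omega)]

lemma polyOfCoeffs_eq_of_coeffMatrix [Fintype J] {A : Type*} [CommRing A]
    {φ : Matrix N J (Polynomial A)} {a : N → ℤ} {b : J → ℤ} {t : ℤ}
    (hφ : ∀ i j, φ i j ∈ Fil A (b j - a i)) {v : (Σ j, Fin (t - b j + 1).toNat) → A}
    {w : (Σ i, Fin (t - a i + 1).toNat) → A}
    (hv : coeffMatrix φ (fun i => (t - a i + 1).toNat) (fun j => (t - b j + 1).toNat) *ᵥ v = w) :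
    φ *ᵥ polyOfCoeffs (fun j => (t - b j + 1).toNat) v =
      polyOfCoeffs (fun i => (t - a i + 1).toNat) w := by
  ext1 i
  ext1 r
  rw [coeff_polyOfCoeffs]
  split_ifs with hr
  · exact (coeffMatrix_mulVec φ _ _ v ⟨i, ⟨r, hr⟩⟩).symm.trans (congrFun hv _)
  · exact mulVec_mem_Fil hφ (polyOfCoeffs_mem_Fil b t v) i r (by omega)

lemma polyOfCoeffs_zero {A : Type*} [CommRing A] (n : J → ℕ) :
    polyOfCoeffs n (0 : (Σ j, Fin (n j)) → A) = 0 := by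
  ext1 j
  simp [polyOfCoeffs]

lemma eq_zero_of_polyOfCoeffs {A : Type*} [CommRing A] {n : J → ℕ} {v : (Σ j, Fin (n j)) → A}
    (h : polyOfCoeffs n v = 0) : v = 0 := by
  ext1 ⟨j, k⟩
  have h3 := coeff_polyOfCoeffs n v j k
  rw [h, dif_pos k.2] at h3
  exact h3.symm

/-- If there are no syzygies of degree `t` generically, then there are none after a suitable
specialization. -/
lemma exists_specialization [Fintype N] [Fintype J] {K σ : Type*} [Field K] [Infinite K]
    {φ : Matrix N J (Polynomial (MvPolynomial σ K))} {a : N → ℤ} {b : J → ℤ} {t : ℤ}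
    (hφ : ∀ i j, φ i j ∈ Fil _ (b j - a i))
    (h : ∀ u : J → Polynomial (MvPolynomial σ K), (∀ j, u j ∈ Fil _ (t - b j)) →
      φ *ᵥ u = 0 → u = 0) :
    ∃ c : σ → K, ∀ u : J → Polynomial K, (∀ j, u j ∈ Fil _ (t - b j)) →
      φ.map (Polynomial.map (eval c)) *ᵥ u = 0 → u = 0 := by
  let n : J → ℕ := fun j => (t - b j + 1).toNat
  let m : N → ℕ := fun i => (t - a i + 1).toNat
  obtain ⟨c, hc⟩ := exists_eval_injective (coeffMatrix φ m n) (by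
    intro v hv
    have h1 : φ *ᵥ polyOfCoeffs n v = 0 := by
      rw [polyOfCoeffs_eq_of_coeffMatrix hφ hv, polyOfCoeffs_zero]
    exact eq_zero_of_polyOfCoeffs (h _ (polyOfCoeffs_mem_Fil b t v) h1))
  refine ⟨c, fun u hu hφu => ?_⟩
  have hmap : (coeffMatrix φ m n).map (eval c) =
      coeffMatrix (φ.map (Polynomial.map (eval c))) m n := by
    ext i j
    simp [coeffMatrix, Polynomial.coeff_mul_X_pow', apply_ite (eval c)]
  have hpu := polyOfCoeffs_coeff hu
  have h0 := hc (fun x => (u x.1).coeff x.2) (by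
    ext1 i
    rw [hmap, coeffMatrix_mulVec, hpu, hφu]
    simp)
  rw [← hpu, h0, polyOfCoeffs_zero]

lemma map_eval_lineMap {K : Type*} [Field K] (c : Fin 2 → K) (q : MvPolynomial (Fin 3) K) :
    Polynomial.map (eval c) (lineMap K (X 0) (X 1) q) = lineMap K (c 0) (c 1) q := by
  induction q using MvPolynomial.induction_on with
  | C c => simp [lineMap, Polynomial.algebraMap_apply]
  | add p q hp hq => rw [map_add, Polynomial.map_add, hp, hq, map_add]
  | mul_X p i hp =>
    rw [map_mul, Polynomial.map_mul, hp, map_mul]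
    congr 1
    fin_cases i <;> simp [lineMap]

/-- Some line carries no syzygies of low degree. -/
lemma exists_line_without_syzygies {K : Type*} [Field K] [CharZero K] {N : Type*} [Fintype N]
    [DecidableEq N] {φ : Matrix N (Fin 2 ⊕ N) (MvPolynomial (Fin 3) K)} {a : N → ℤ}
    {b : Fin 2 ⊕ N → ℤ} (hφ : ∀ i j, φ i j ∈ hcomp K 3 (b j - a i)) {M : ℕ}
    (hI : ∀ i, X i ^ M ∈ minorIdeal φ) {p : ℤ} (hp : 2 * p + 1 < (∑ j, b j) - ∑ i, a i)
    (hpb : ∀ j, p < (∑ j, b j) - (∑ i, a i) - b j) :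
    ∃ α β : K, ∀ u : Fin 2 ⊕ N → Polynomial K, (∀ j, u j ∈ Fil _ (p - b j)) →
      φ.map (lineMap K α β) *ᵥ u = 0 → u = 0 := by
  obtain ⟨c, hc⟩ := exists_specialization (t := p)
    (φ := φ.map (lineMap K (X 0 : MvPolynomial (Fin 2) K) (X 1)))
    (fun i j => lineMap_mem_Fil _ _ (hφ i j))
    fun u hu h => eq_zero_of_generic_syzygy hφ hI hp hpb hu h
  refine ⟨c 0, c 1, fun u hu h => hc u hu ?_⟩
  convert h using 2
  ext1 i j
  simp [map_eval_lineMap]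

end Specialize

/-! ### Surjectivity on a line without syzygies -/

section Surjectivity

variable {A : Type*} [CommRing A]

/-- The coefficient in degree `k` of a polynomial of degree at most `k`. -/
noncomputable def topCoeff (k : ℤ) (q : Polynomial A) : A := if 0 ≤ k then q.coeff k.toNat else 0

lemma natDegree_le_of_mem_Fil {k : ℤ} {q : Polynomial A} (hq : q ∈ Fil A k) :
    q.natDegree ≤ k.toNat :=
  Polynomial.natDegree_le_iff_coeff_eq_zero.mpr fun i hi => hq i (by omega)

lemma topCoeff_mul {i j k : ℤ} {p q : Polynomial A} (hp : p ∈ Fil A i) (hq : q ∈ Fil A j)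
    (hk : i + j = k) : topCoeff k (p * q) = topCoeff i p * topCoeff j q := by
  subst hk
  by_cases hi : 0 ≤ i
  · by_cases hj : 0 ≤ j
    · rw [topCoeff, topCoeff, topCoeff, if_pos hi, if_pos hj, if_pos (by omega),
        Int.toNat_add hi hj]
      exact Polynomial.coeff_mul_add_eq_of_natDegree_le (natDegree_le_of_mem_Fil hp)
        (natDegree_le_of_mem_Fil hq)
    · rw [eq_zero_of_mem_Fil hq (not_le.mp hj)]
      simp [topCoeff]
  · rw [eq_zero_of_mem_Fil hp (not_le.mp hi)]
    simp [topCoeff]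

lemma topCoeff_pow {p : Polynomial A} (hp : p ∈ Fil A 1) (n : ℕ) :
    p ^ n ∈ Fil A n ∧ topCoeff n (p ^ n) = topCoeff 1 p ^ n := by
  induction n with
  | zero => exact ⟨by simpa using SetLike.GradedOne.one_mem (A := Fil A), by simp [topCoeff]⟩
  | succ n ih =>
    rw [pow_succ, pow_succ, ← ih.2]
    exact ⟨Fil_mul_mem ih.1 hp (by push_cast; ring), topCoeff_mul ih.1 hp (by push_cast; ring)⟩

lemma topCoeff_sum {ι : Type*} (s : Finset ι) (k : ℤ) (f : ι → Polynomial A) :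
    topCoeff k (∑ i ∈ s, f i) = ∑ i ∈ s, topCoeff k (f i) := by
  unfold topCoeff
  split_ifs
  · exact Polynomial.finsetSum_coeff _ _ _
  · simp

lemma mem_Fil_pred {k : ℤ} {q : Polynomial A} (hq : q ∈ Fil A k) (h : topCoeff k q = 0) :
    q ∈ Fil A (k - 1) := by
  intro i hi
  by_cases hik : k < i
  · exact hq i hik
  · rw [topCoeff, if_pos (by omega)] at h
    convert h
    omega

variable {K : Type*} [Field K]

lemma topCoeff_lineMap (α β : K) {z : ℤ} {q : MvPolynomial (Fin 3) K} (hq : q ∈ hcomp K 3 z) :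
    topCoeff z (lineMap K α β q) = eval ![0, 1, β] q := by
  rw [lineMap, aeval_def, eval₂_eq', eval_eq', topCoeff_sum]
  refine Finset.sum_congr rfl fun e he => ?_
  have hz := mem_hcomp.mp hq e he
  rw [Finsupp.degree_eq_sum, Fin.sum_univ_three] at hz
  rw [Fin.prod_univ_three, Fin.prod_univ_three, Polynomial.algebraMap_apply]
  have h0 : (1 : Polynomial K) ∈ Fil K 1 := Fil_mono zero_le_one SetLike.GradedOne.one_mem
  have h2 : (Polynomial.C α + Polynomial.C β * Polynomial.X) ∈ Fil K 1 :=
    add_mem (Fil_mono zero_le_one (C_mem_Fil α))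
      (Fil_mul_mem (C_mem_Fil β) X_mem_Fil (zero_add 1))
  have p0 := topCoeff_pow h0 (e 0)
  have p1 := topCoeff_pow (X_mem_Fil (A := K)) (e 1)
  have p2 := topCoeff_pow h2 (e 2)
  have p01 := Fil_mul_mem p0.1 p1.1 rfl
  change topCoeff z (_ * (1 ^ e 0 * Polynomial.X ^ e 1 *
    (Polynomial.C α + Polynomial.C β * Polynomial.X) ^ e 2)) = _
  rw [topCoeff_mul (C_mem_Fil _) (Fil_mul_mem p01 p2.1 rfl) (by push_cast at hz; omega),
    topCoeff_mul p01 p2.1 rfl, topCoeff_mul p0.1 p1.1 rfl, p0.2, p1.2, p2.2]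
  simp [topCoeff, Polynomial.coeff_one, Polynomial.coeff_C]

lemma surjective_of_kernel_bound {ι κ ν : Type*} [Fintype ι] [Fintype κ] [Fintype ν]
    (T : Matrix κ ι K) (θ : (ι → K) →ₗ[K] (ν → K))
    (hθ : ∀ v, T *ᵥ v = 0 → θ v = 0 → v = 0)
    (hcard : Fintype.card ι = Fintype.card κ + Fintype.card ν) (w : κ → K) :
    ∃ v, T *ᵥ v = w := by
  have h1 : Module.finrank K (LinearMap.ker T.mulVecLin) ≤ Fintype.card ν := by
    rw [← Module.finrank_fintype_fun_eq_card (R := K)]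
    refine LinearMap.finrank_le_finrank_of_injective (f := θ.domRestrict _) ?_
    rw [injective_iff_map_eq_zero]
    rintro ⟨v, hv⟩ h
    exact Subtype.ext (hθ v hv h)
  have h2 := T.mulVecLin.finrank_range_add_finrank_ker
  have h3 := T.mulVecLin.range.finrank_le
  rw [Module.finrank_fintype_fun_eq_card] at h2 h3
  have h4 : LinearMap.range T.mulVecLin = ⊤ :=
    Submodule.eq_top_of_finrank_eq (by rw [Module.finrank_fintype_fun_eq_card]; omega)
  exact LinearMap.range_eq_top.mp h4 w

variable {N : Type*} [Fintype N] [DecidableEq N]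
  {φ : Matrix N (Fin 2 ⊕ N) (MvPolynomial (Fin 3) K)} {a : N → ℤ} {b : Fin 2 ⊕ N → ℤ}

/-- In the even case a syzygy of degree `v` is determined by two of its top coefficients. -/
lemma exists_pair_determining (hφ : ∀ i j, φ i j ∈ hcomp K 3 (b j - a i)) {M : ℕ}
    (hI : ∀ i, X i ^ M ∈ minorIdeal φ) (α β : K) (v : ℤ) :
    ∃ j k, ∀ u : Fin 2 ⊕ N → Polynomial K, (∀ j, u j ∈ Fil _ (v - b j)) →
      φ.map (lineMap K α β) *ᵥ u = 0 → topCoeff (v - b j) (u j) = 0 →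
      topCoeff (v - b k) (u k) = 0 → ∀ l, topCoeff (v - b l) (u l) = 0 := by
  have hone : (1 : K) ∈ minorIdeal (φ.map (eval ![0, 1, β])) := by
    obtain ⟨c, hc⟩ := Ideal.mem_span_range_iff_exists_fun.mp (hI 1)
    refine Ideal.mem_span_range_iff_exists_fun.mpr ⟨fun g => eval ![0, 1, β] (c g), ?_⟩
    apply_fun eval ![0, 1, β] at hc
    simp only [map_sum, map_mul, RingHom.map_det, map_pow, eval_X, cons_val_one,
      cons_val_zero, one_pow] at hc
    exact hc
  obtain ⟨j, k, hjk⟩ := exists_stackDet_ne_zero _ hone one_ne_zero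
  refine ⟨j, k, fun u hu hφu hj hk => ?_⟩
  have h1 : φ.map (eval ![0, 1, β]) *ᵥ (fun l => topCoeff (v - b l) (u l)) = 0 := by
    ext1 i
    have h2 := congrArg (topCoeff (v - a i)) (congrFun hφu i)
    simp only [mulVec, dotProduct, topCoeff_sum, map_apply] at h2
    rw [Finset.sum_congr rfl fun l _ => by
      rw [topCoeff_mul (lineMap_mem_Fil α β (hφ i l)) (hu l) (by ring),
        topCoeff_lineMap α β (hφ i l)]] at h2
    simpa [mulVec, dotProduct, topCoeff] using h2
  have h3 : fromRows (of ![Pi.single j 1, Pi.single k 1]) (φ.map (eval ![0, 1, β])) *ᵥ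
      (fun l => topCoeff (v - b l) (u l)) = 0 := by
    rw [fromRows_mulVec, h1]
    ext1 x
    rcases x with x | x
    · fin_cases x
      · simpa [mulVec] using hj
      · simpa [mulVec] using hk
    · rfl
  exact fun l => congrFun (Matrix.eq_zero_of_mulVec_eq_zero hjk h3) l


lemma exists_preimage_of_kernel_bound {P J ν : Type*} [Fintype P] [Fintype J] [Fintype ν]
    {Φ : Matrix P J (Polynomial K)} {a : P → ℤ} {b : J → ℤ} (hΦ : ∀ i j, Φ i j ∈ Fil K (b j - a i)) {v : ℤ}
    (idx : ν → J)
    (hker : ∀ u : J → Polynomial K, (∀ j, u j ∈ Fil _ (v - b j)) → Φ *ᵥ u = 0 →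
      (∀ x, topCoeff (v - b (idx x)) (u (idx x)) = 0) → u = 0)
    (hcard : ∑ j, (v - b j + 1).toNat = (∑ i, (v - a i + 1).toNat) + Fintype.card ν)
    {f : P → Polynomial K} (hf : ∀ i, f i ∈ Fil _ (v - a i)) :
    ∃ u : J → Polynomial K, (∀ j, u j ∈ Fil _ (v - b j)) ∧ Φ *ᵥ u = f := by
  let θ : ((Σ j, Fin (v - b j + 1).toNat) → K) →ₗ[K] (ν → K) :=
    LinearMap.pi fun x => if h : 0 ≤ v - b (idx x) then
      LinearMap.proj ⟨idx x, ⟨(v - b (idx x)).toNat, by omega⟩⟩ else 0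
  obtain ⟨w, hw⟩ := surjective_of_kernel_bound
    (coeffMatrix Φ (fun i => (v - a i + 1).toNat) (fun j => (v - b j + 1).toNat)) θ (by
      intro w hw hθ
      refine eq_zero_of_polyOfCoeffs (hker _ (polyOfCoeffs_mem_Fil b v w) ?_ fun x => ?_)
      · rw [polyOfCoeffs_eq_of_coeffMatrix hΦ hw, polyOfCoeffs_zero]
      · have h1 := congrFun hθ x
        simp only [θ, LinearMap.pi_apply] at h1
        rw [topCoeff]
        split_ifs at h1 ⊢ with h
        · rw [coeff_polyOfCoeffs, dif_pos (by omega)]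
          exact h1
        · rfl)
    (by simpa [Fintype.card_sigma] using hcard) (fun x => (f x.1).coeff x.2)
  exact ⟨_, polyOfCoeffs_mem_Fil b v w, by
    rw [polyOfCoeffs_eq_of_coeffMatrix hΦ hw, polyOfCoeffs_coeff hf]⟩

/-- On a line without syzygies of degree `v - 1`, where `v` is half the total degree rounded
down, `φ` is surjective in degree `v`. -/
lemma exists_preimage_middle (hφ : ∀ i j, φ i j ∈ hcomp K 3 (b j - a i)) {M : ℕ}
    (hI : ∀ i, X i ^ M ∈ minorIdeal φ) {α β : K} {v : ℤ}
    (hd : 2 * v = (∑ j, b j) - ∑ i, a i ∨ 2 * v + 1 = (∑ j, b j) - ∑ i, a i)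
    (hb : ∀ j, b j ≤ v) (ha : ∀ i, a i ≤ v + 1)
    (hno : ∀ u : Fin 2 ⊕ N → Polynomial K, (∀ j, u j ∈ Fil _ (v - 1 - b j)) →
      φ.map (lineMap K α β) *ᵥ u = 0 → u = 0)
    {f : N → Polynomial K} (hf : ∀ i, f i ∈ Fil _ (v - a i)) :
    ∃ u : Fin 2 ⊕ N → Polynomial K, (∀ j, u j ∈ Fil _ (v - b j)) ∧
      φ.map (lineMap K α β) *ᵥ u = f := by
  have hΦ : ∀ i j, φ.map (lineMap K α β) i j ∈ Fil K (b j - a i) :=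
    fun i j => lineMap_mem_Fil α β (hφ i j)
  have htop : ∀ u : Fin 2 ⊕ N → Polynomial K, (∀ j, u j ∈ Fil _ (v - b j)) →
      φ.map (lineMap K α β) *ᵥ u = 0 → (∀ l, topCoeff (v - b l) (u l) = 0) → u = 0 := by
    intro u hu h0 ht
    refine hno u (fun j => ?_) h0
    rw [sub_right_comm]
    exact mem_Fil_pred (hu j) (ht j)
  have hcard : ((∑ j, (v - b j + 1).toNat : ℕ) : ℤ) =
      ((∑ i, (v - a i + 1).toNat : ℕ) : ℤ) + (2 * v + 2 - ((∑ j, b j) - ∑ i, a i)) := by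
    have h1 : ∀ j, ((v - b j + 1).toNat : ℤ) = v + 1 - b j := fun j => by have := hb j; omega
    have h2 : ∀ i, ((v - a i + 1).toNat : ℤ) = v + 1 - a i := fun i => by have := ha i; omega
    push_cast [h1, h2]
    simp only [Finset.sum_sub_distrib, Finset.sum_const, Finset.card_univ, Fintype.card_sum,
      Fintype.card_fin, nsmul_eq_mul]
    push_cast
    ring
  rcases hd with hd | hd
  · obtain ⟨j, k, hjk⟩ := exists_pair_determining hφ hI α β v
    exact exists_preimage_of_kernel_bound hΦ ![j, k]
      (fun u hu h0 h => htop u hu h0 (hjk u hu h0 (h 0) (h 1)))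
      (by rw [Fintype.card_fin]; omega) hf
  · obtain ⟨k, hk⟩ : ∃ k, ∀ u : Fin 2 ⊕ N → Polynomial K, (∀ j, u j ∈ Fil _ (v - b j)) →
        φ.map (lineMap K α β) *ᵥ u = 0 → topCoeff (v - b k) (u k) = 0 →
        ∀ l, topCoeff (v - b l) (u l) = 0 := by
      by_contra! h
      obtain ⟨w, hw, h0, -, k, hk⟩ := h (Sum.inl 0)
      obtain ⟨u, hu, hu0, huk, l, hl⟩ := h k
      have h1 := congrArg (topCoeff (v - b l + (v - b k)))
        (syzygy_parallel hφ hI α β (by omega) hu hw hu0 h0 l k)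
      rw [topCoeff_mul (hu l) (hw k) rfl, topCoeff_mul (hu k) (hw l) (add_comm _ _), huk,
        zero_mul] at h1
      exact mul_ne_zero hl hk h1
    exact exists_preimage_of_kernel_bound (ν := Fin 1) hΦ (fun _ => k)
      (fun u hu h0 h => htop u hu h0 (hk u hu h0 (h 0)))
      (by rw [Fintype.card_fin]; omega) hf

lemma exists_preimage_succ {P J : Type*} [Fintype J]
    {Φ : Matrix P J (Polynomial K)} {a : P → ℤ} {b : J → ℤ} {v : ℤ} (ha : ∀ i, a i ≤ v)
    (h : ∀ f : P → Polynomial K, (∀ i, f i ∈ Fil _ (v - a i)) →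
      ∃ u : J → Polynomial K, (∀ j, u j ∈ Fil _ (v - b j)) ∧ Φ *ᵥ u = f)
    {f : P → Polynomial K} (hf : ∀ i, f i ∈ Fil _ (v + 1 - a i)) :
    ∃ u : J → Polynomial K, (∀ j, u j ∈ Fil _ (v + 1 - b j)) ∧ Φ *ᵥ u = f := by
  obtain ⟨u₀, hu₀, h₀⟩ := h (fun i => Polynomial.C ((f i).coeff 0)) fun i =>
    Fil_mono (by have := ha i; omega) (C_mem_Fil _)
  obtain ⟨u₁, hu₁, h₁⟩ := h (fun i => (f i).divX) fun i k hk => by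
    rw [Polynomial.coeff_divX]
    exact hf i _ (by push_cast; omega)
  refine ⟨u₀ + (Polynomial.X : Polynomial K) • u₁, fun j => ?_, ?_⟩
  · refine add_mem (Fil_mono (by omega) (hu₀ j)) ?_
    exact Fil_mul_mem X_mem_Fil (hu₁ j) (by ring)
  · rw [mulVec_add, mulVec_smul, h₀, h₁]
    ext1 i
    rw [Pi.add_apply, Pi.smul_apply, smul_eq_mul, add_comm]
    exact Polynomial.X_mul_divX_add _

/-- Surjectivity propagates to all higher degrees. -/
lemma exists_preimage_of_le {P J : Type*} [Fintype J]
    {Φ : Matrix P J (Polynomial K)} {a : P → ℤ} {b : J → ℤ} {v w : ℤ} (ha : ∀ i, a i ≤ v) (hvw : v ≤ w)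
    (h : ∀ f : P → Polynomial K, (∀ i, f i ∈ Fil _ (v - a i)) →
      ∃ u : J → Polynomial K, (∀ j, u j ∈ Fil _ (v - b j)) ∧ Φ *ᵥ u = f) :
    ∀ f : P → Polynomial K, (∀ i, f i ∈ Fil _ (w - a i)) →
      ∃ u : J → Polynomial K, (∀ j, u j ∈ Fil _ (w - b j)) ∧ Φ *ᵥ u = f := by
  induction w, hvw using Int.leInduction with
  | base => exact h
  | succ w hw ih => exact fun f hf => exists_preimage_succ (fun i => (ha i).trans hw) ih hf

end Surjectivity

/-! ### Multiplication by a linear form -/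

section LinearForm

variable {K : Type*} [Field K]

/-- The linear form `α x + β y - z`. -/
noncomputable def linForm (α β : K) : MvPolynomial (Fin 3) K := C α * X 0 + C β * X 1 - X 2

lemma isHomogeneous_linForm (α β : K) : (linForm α β).IsHomogeneous 1 :=
  (((isHomogeneous_C_mul_X α 0).add (isHomogeneous_C_mul_X β 1)).sub (isHomogeneous_X K 2))

lemma linForm_mem_hcomp (α β : K) : linForm α β ∈ hcomp K 3 1 :=
  mem_hcomp_of_isHomogeneous (isHomogeneous_linForm α β) (by simp)

lemma lineMap_linForm (α β : K) : lineMap K α β (linForm α β) = 0 := by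
  simp [linForm, lineMap]

lemma linForm_ne_zero (α β : K) : linForm α β ≠ 0 := by
  intro h
  have := congrArg (eval ![0, 0, 1]) h
  simp [linForm] at this

/-- The substitution `z = α x + β y`. -/
noncomputable def substLine (α β : K) : MvPolynomial (Fin 3) K →ₐ[K] MvPolynomial (Fin 3) K :=
  aeval ![X 0, X 1, C α * X 0 + C β * X 1]

lemma linForm_dvd_sub_substLine (α β : K) (q : MvPolynomial (Fin 3) K) :
    linForm α β ∣ q - substLine α β q := by
  induction q using MvPolynomial.induction_on with
  | C c => simp [substLine]
  | add p q hp hq =>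
    rw [map_add, add_sub_add_comm]
    exact dvd_add hp hq
  | mul_X p i hp =>
    have hX : linForm α β ∣ X i - substLine α β (X i) := by
      fin_cases i
      · simp [substLine]
      · simp [substLine]
      · exact ⟨-1, by simp [substLine, linForm]⟩
    rw [map_mul]
    have : p * X i - substLine α β p * substLine α β (X i) =
      (p - substLine α β p) * X i + substLine α β p * (X i - substLine α β (X i)) := by ring
    rw [this]
    exact dvd_add (hp.mul_right _) (hX.mul_left _)

lemma substLine_mem_hcomp (α β : K) {z : ℤ} {q : MvPolynomial (Fin 3) K} (hq : q ∈ hcomp K 3 z) :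
    substLine α β q ∈ hcomp K 3 z := by
  rcases lt_or_ge z 0 with hz | hz
  · rw [hcomp_eq_zero_of_neg hq hz, map_zero]
    exact zero_mem _
  · rw [hcomp, if_pos hz] at hq ⊢
    have h : (substLine α β q).IsHomogeneous (1 * z.toNat) := IsHomogeneous.aeval hq _ (by
      intro i
      fin_cases i
      · exact isHomogeneous_X K 0
      · exact isHomogeneous_X K 1
      · exact (isHomogeneous_C_mul_X α 0).add (isHomogeneous_C_mul_X β 1))
    rw [one_mul] at h
    exact h

lemma dehom_substLine (α β : K) (q : MvPolynomial (Fin 3) K) :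
    dehom K (substLine α β q) =
      Polynomial.aeval (X 1 : MvPolynomial (Fin 2) K) (lineMap K α β q) := by
  induction q using MvPolynomial.induction_on with
  | C c => simp [substLine, dehom, lineMap]
  | add p q hp hq => simp only [map_add, hp, hq]
  | mul_X p i hp =>
    simp only [map_mul, hp]
    congr 1
    fin_cases i <;> simp [substLine, dehom, lineMap, algebraMap_eq]

/-- The kernel of restriction to the line is generated by the linear form. -/
lemma linForm_dvd_of_lineMap_eq_zero (α β : K) {z : ℤ} {q : MvPolynomial (Fin 3) K}
    (hq : q ∈ hcomp K 3 z) (h : lineMap K α β q = 0) : linForm α β ∣ q := by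
  have h1 : substLine α β q = 0 :=
    eq_zero_of_dehom_eq_zero (substLine_mem_hcomp α β hq) (by rw [dehom_substLine, h, map_zero])
  simpa [h1] using linForm_dvd_sub_substLine α β q

lemma exists_eq_linForm_smul {P : Type*} (α β : K) {a : P → ℤ} {t : ℤ}
    {g : P → MvPolynomial (Fin 3) K} (hg : ∀ i, g i ∈ hcomp K 3 (t - a i))
    (h : ∀ i, lineMap K α β (g i) = 0) :
    ∃ g' : P → MvPolynomial (Fin 3) K, (∀ i, g' i ∈ hcomp K 3 (t - 1 - a i)) ∧
      linForm α β • g' = g := by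
  choose g' hg' using fun i => linForm_dvd_of_lineMap_eq_zero α β (hg i) (h i)
  refine ⟨fun i => compZ K 3 (t - 1 - a i) (g' i), fun i => compZ_mem _ _ _, ?_⟩
  ext1 i
  have h1 := compZ_of_mem (z := t - a i) (hg i)
  rw [if_pos rfl] at h1
  rw [← h1, hg', compZ_mul (linForm_mem_hcomp α β), Pi.smul_apply, smul_eq_mul, sub_right_comm]

lemma exists_lineMap_eq (α β : K) {z : ℤ} {q : Polynomial K} (hq : q ∈ Fil K z) :
    ∃ f ∈ hcomp K 3 z, lineMap K α β f = q := by
  refine ⟨∑ e ∈ q.support, C (q.coeff e) * (X 0 ^ (z.toNat - e) * X 1 ^ e),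
    sum_mem fun e he => ?_, ?_⟩
  · have : (e : ℤ) ≤ z := by
      by_contra h
      exact Polynomial.mem_support_iff.mp he (hq e (by omega))
    refine mem_hcomp_of_isHomogeneous ((isHomogeneous_C _ _).mul
      ((isHomogeneous_X_pow _ _).mul (isHomogeneous_X_pow _ _))) ?_
    push_cast
    omega
  · conv_rhs => rw [q.as_sum_support_C_mul_X_pow]
    rw [map_sum]
    refine Finset.sum_congr rfl fun e _ => ?_
    rw [map_mul, map_mul, map_pow, map_pow, lineMap_X_zero, lineMap_X_one, one_pow, one_mul]
    simp [lineMap]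

lemma lineMap_mulVec {P J : Type*} [Fintype J] (α β : K)
    (φ : Matrix P J (MvPolynomial (Fin 3) K)) (f : J → MvPolynomial (Fin 3) K) (i : P) :
    lineMap K α β ((φ *ᵥ f) i) =
      (φ.map (lineMap K α β) *ᵥ fun j => lineMap K α β (f j)) i := by
  simp [mulVec, dotProduct]

variable {N : Type*} [Fintype N] [DecidableEq N]
  {φ : Matrix N (Fin 2 ⊕ N) (MvPolynomial (Fin 3) K)} {a : N → ℤ} {b : Fin 2 ⊕ N → ℤ}

/-- The weak Lefschetz property of the cokernel, phrased with representatives. -/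
lemma exists_linForm_injective_or_surjective [CharZero K]
    (hφ : ∀ i j, φ i j ∈ hcomp K 3 (b j - a i)) {M : ℕ} (hI : ∀ i, X i ^ M ∈ minorIdeal φ)
    (hb : ∀ j, 2 * b j ≤ (∑ j, b j) - ∑ i, a i) (ha : ∀ i, ∃ j, a i < b j) :
    ∃ ℓ : MvPolynomial (Fin 3) K, ℓ.IsHomogeneous 1 ∧ ∀ t : ℤ,
      (∀ g : N → MvPolynomial (Fin 3) K, (∀ i, g i ∈ hcomp K 3 (t - a i)) →
        (∃ f, φ *ᵥ f = ℓ • g) → ∃ f, φ *ᵥ f = g) ∨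
      (∀ g : N → MvPolynomial (Fin 3) K, (∀ i, g i ∈ hcomp K 3 (t + 1 - a i)) →
        ∃ g' : N → MvPolynomial (Fin 3) K, (∀ i, g' i ∈ hcomp K 3 (t - a i)) ∧
          ∃ f, φ *ᵥ f + ℓ • g' = g) := by
  obtain ⟨v, hv⟩ : ∃ v, v = ((∑ j, b j) - ∑ i, a i) / 2 := ⟨_, rfl⟩
  have hbv : ∀ j, b j ≤ v := fun j => by have := hb j; omega
  have hav : ∀ i, a i ≤ v := fun i => by obtain ⟨j, hj⟩ := ha i; have := hbv j; omega
  obtain ⟨α, β, hno⟩ := exists_line_without_syzygies hφ hI (p := v - 1) (by omega)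
    (fun j => by have := hb j; omega)
  refine ⟨linForm α β, isHomogeneous_linForm α β, fun t => ?_⟩
  rcases lt_or_ge (t + 1) v with ht | ht
  · left
    rintro g hg ⟨f, hf⟩
    have hlg : ∀ i, (linForm α β • g) i ∈ hcomp K 3 (t + 1 - a i) := fun i =>
      hcomp_mul_mem (linForm_mem_hcomp α β) (hg i) (by ring)
    obtain ⟨f', hf', hff'⟩ := exists_homogeneous_preimage hφ (t := t + 1) (f := f)
      (fun i => by rw [hf]; exact hlg i)
    rw [hf] at hff'
    have h0 := hno (fun j => lineMap K α β (f' j))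
      (fun j => Fil_mono (by omega) (lineMap_mem_Fil α β (hf' j))) (by
        ext1 i
        rw [← lineMap_mulVec, hff', Pi.smul_apply, smul_eq_mul, map_mul, lineMap_linForm,
          zero_mul, Pi.zero_apply])
    obtain ⟨f'', -, hf''⟩ := exists_eq_linForm_smul α β hf' (congrFun h0)
    refine ⟨f'', ?_⟩
    rw [← hf'', mulVec_smul] at hff'
    exact smul_right_injective _ (linForm_ne_zero α β) hff'
  · right
    intro g hg
    obtain ⟨u, hu, hug⟩ := exists_preimage_of_le hav ht
      (fun f hf => exists_preimage_middle hφ hI (α := α) (β := β) (by omega) hbv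
        (fun i => (hav i).trans (by omega)) hno hf)
      (fun i => lineMap K α β (g i)) (fun i => lineMap_mem_Fil α β (hg i))
    choose f hf hfu using fun j => exists_lineMap_eq α β (hu j)
    obtain ⟨g', hg', h⟩ := exists_eq_linForm_smul α β (a := a) (t := t + 1) (g := g - φ *ᵥ f)
      (fun i => sub_mem (hg i) (mulVec_mem_hcomp hφ hf i)) (fun i => by
        rw [Pi.sub_apply, map_sub, lineMap_mulVec, funext hfu, hug, sub_self])
    exact ⟨g', fun i => by simpa using hg' i, f, by rw [h, add_sub_cancel]⟩

end LinearForm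

/-! ### The maximal ideal is the radical of an ideal of minors of height three -/

section Height

variable {K : Type*} [Field K]

/-- Restriction to the line through the origin and `c`. -/
noncomputable def coneMap (c : Fin 3 → K) : MvPolynomial (Fin 3) K →ₐ[K] Polynomial K :=
  aeval fun i => Polynomial.C (c i) * Polynomial.X

lemma coneMap_eq (c : Fin 3 → K) {z : ℤ} {q : MvPolynomial (Fin 3) K} (hq : q ∈ hcomp K 3 z) :
    coneMap c q = Polynomial.C (eval c q) * Polynomial.X ^ z.toNat := by
  rw [coneMap, aeval_def, eval₂_eq', eval_eq', map_sum, Finset.sum_mul]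
  refine Finset.sum_congr rfl fun e he => ?_
  have hz := mem_hcomp.mp hq e he
  rw [Finsupp.degree_eq_sum] at hz
  simp only [mul_pow, Finset.prod_mul_distrib, Finset.prod_pow_eq_pow_sum]
  rw [show z.toNat = ∑ i, e i by omega, map_mul, map_prod, mul_assoc]
  simp only [map_pow, Polynomial.algebraMap_apply, Algebra.algebraMap_self, RingHom.id_apply]

lemma height_primeSpectrum_le (p : PrimeSpectrum (MvPolynomial (Fin 3) K)) :
    Order.height p ≤ 3 := by
  have h := Order.height_le_krullDim p
  change _ ≤ ringKrullDim _ at h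
  rw [MvPolynomial.ringKrullDim_of_isNoetherianRing, ringKrullDim_eq_zero_of_field] at h
  simp only [Nat.card_eq_fintype_card, Fintype.card_fin, zero_add] at h
  exact WithBot.coe_le_coe.mp h

lemma eq_zero_of_mem_zeroLocus {S : Set (MvPolynomial (Fin 3) K)}
    (hS : ∀ q ∈ S, ∃ z, q ∈ hcomp K 3 z) (hht : idealHeight (Ideal.span S) = 3) {c : Fin 3 → K}
    (hc : c ∈ zeroLocus K (Ideal.span S)) : c = 0 := by
  by_contra hne
  obtain ⟨i, hi⟩ := Function.ne_iff.mp hne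
  let p : PrimeSpectrum (MvPolynomial (Fin 3) K) := ⟨_, RingHom.ker_isPrime (coneMap c)⟩
  let m : PrimeSpectrum (MvPolynomial (Fin 3) K) :=
    ⟨_, RingHom.ker_isPrime (aeval (0 : Fin 3 → K))⟩
  have hp : Ideal.span S ≤ p.asIdeal := by
    refine Ideal.span_le.mpr fun q hq => ?_
    obtain ⟨z, hz⟩ := hS q hq
    have h0 : eval c q = 0 := by
      rw [← coe_aeval_eq_eval]
      exact hc q (Ideal.subset_span hq)
    change coneMap c q = 0
    rw [coneMap_eq c hz, h0, map_zero, zero_mul]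
  have hpm : p < m := by
    have hle : ∀ q, aeval (0 : Fin 3 → K) q = Polynomial.aeval (0 : K) (coneMap c q) := by
      intro q
      induction q using MvPolynomial.induction_on with
      | C r => simp [coneMap]
      | add p q hp hq => simp only [map_add, hp, hq]
      | mul_X p j hp => simp [coneMap]
    refine lt_of_le_of_ne (fun q hq => ?_) fun h => ?_
    · change aeval (0 : Fin 3 → K) q = 0
      rw [hle, show coneMap c q = 0 from hq, map_zero]
    · have h1 : (X i : MvPolynomial (Fin 3) K) ∈ m.asIdeal := by
        change aeval (0 : Fin 3 → K) (X i) = 0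
        simp
      rw [← h] at h1
      have h2 : coneMap c (X i) = 0 := h1
      rw [coneMap, aeval_X] at h2
      exact mul_ne_zero (Polynomial.C_ne_zero.mpr hi) Polynomial.X_ne_zero h2
  have h1 : 3 ≤ Order.height p := hht ▸ iInf₂_le p hp
  have h2 := (Order.height_add_one_le hpm).trans (height_primeSpectrum_le m)
  have h3 : (3 : ℕ∞) + 1 ≤ 3 := (add_le_add_left h1 1).trans h2
  exact absurd h3 (by decide)

lemma exists_X_pow_mem [IsAlgClosed K] {S : Set (MvPolynomial (Fin 3) K)}
    (hS : ∀ q ∈ S, ∃ z, q ∈ hcomp K 3 z) (hht : idealHeight (Ideal.span S) = 3) :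
    ∃ M : ℕ, ∀ i, X i ^ M ∈ Ideal.span S := by
  have h : ∀ i, ∃ k : ℕ, (X i : MvPolynomial (Fin 3) K) ^ k ∈ Ideal.span S := fun i => by
    change X i ∈ (Ideal.span S).radical
    rw [← vanishingIdeal_zeroLocus_eq_radical (K := K)]
    intro c hc
    rw [eq_zero_of_mem_zeroLocus hS hht hc]
    simp
  choose k hk using h
  refine ⟨∑ i, k i, fun i => ?_⟩
  rw [← Finset.add_sum_erase _ _ (Finset.mem_univ i), pow_add]
  exact Ideal.mul_mem_right _ _ (hk i)

end Height

lemma mem_cokerPiece {K : Type*} [Field K] {n m : ℕ}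
    {φ : Matrix (Fin n) (Fin m) (MvPolynomial (Fin 3) K)} {a : Fin n → ℤ} {t : ℤ}
    {x : (Fin n → MvPolynomial (Fin 3) K) ⧸ LinearMap.range φ.mulVecLin} :
    x ∈ cokerPiece φ a t ↔ ∃ g : Fin n → MvPolynomial (Fin 3) K,
      (∀ i, g i ∈ hcomp K 3 (t - a i)) ∧ Submodule.Quotient.mk g = x := by
  simp [cokerPiece, Submodule.mem_map, Submodule.mem_pi]

/-- The columns, two of them singled out. -/
def colEquiv (n : ℕ) : Fin 2 ⊕ Fin n ≃ Fin (n + 2) :=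
  finSumFinEquiv.trans (finCongr (Nat.add_comm 2 n))

end LefschetzRankTwo

/-- Suppose `K` has characteristic zero and `a₁ = 0`.  Set
`d = ∑ b j - ∑ a i` and `d' = ∑_{i=1}^n (b i - a i)`.  If either (a) `d` is even and
`d' + 2 + b_{n+1} > b_{n+2}`, or (b) `d` is odd and `d' + 1 + b_{n+1} > b_{n+2}`,
then `M = coker φ` has the Weak Lefschetz Property: there is a linear form `ℓ` such
that for every `t` the multiplication map `×ℓ : M_t → M_{t+1}` is injective or
surjective. -/
theorem stmt9 {K : Type*} [Field K] [IsAlgClosed K] [CharZero K]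
    (n : ℕ) (hn : 0 < n) (a : Fin n → ℤ) (b : Fin (n + 2) → ℤ)
    (ha : Monotone a) (hb : Monotone b)
    (φ : Matrix (Fin n) (Fin (n + 2)) (MvPolynomial (Fin 3) K))
    (hφ : ∀ i j, φ i j = 0 ∨
      (0 < b j - a i ∧ (φ i j).IsHomogeneous (b j - a i).toNat))
    (I : Ideal (MvPolynomial (Fin 3) K))
    (hI : I = Ideal.span {m | ∃ g : Fin n → Fin (n + 2),
        Function.Injective g ∧ m = (φ.submatrix id g).det})
    (hht : idealHeight I = 3)
    (ha1 : a ⟨0, hn⟩ = 0)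
    (d d' : ℤ)
    (hd : d = (∑ j, b j) - ∑ i, a i)
    (hd' : d' = ∑ i : Fin n, (b (Fin.castLE (by omega) i) - a i))
    (hcond : (Even d ∧ b ⟨n + 1, by omega⟩ < d' + 2 + b ⟨n, by omega⟩) ∨
             (Odd d ∧ b ⟨n + 1, by omega⟩ < d' + 1 + b ⟨n, by omega⟩)) :
    ∃ ℓ : MvPolynomial (Fin 3) K, ℓ.IsHomogeneous 1 ∧
      ∀ t : ℤ,
        (∀ x ∈ cokerPiece φ a t, ℓ • x = 0 → x = 0) ∨
        (∀ y ∈ cokerPiece φ a (t + 1), ∃ x ∈ cokerPiece φ a t, ℓ • x = y) := by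
  let e := LefschetzRankTwo.colEquiv n
  have hgr : ∀ i j, φ.submatrix id e i j ∈ hcomp K 3 (b (e j) - a i) := by
    intro i j
    rw [Matrix.submatrix_apply, id]
    rcases hφ i (e j) with h | ⟨h, h'⟩
    · rw [h]
      exact zero_mem _
    · exact LefschetzRankTwo.mem_hcomp_of_isHomogeneous h' (by omega)
  have hminor : ∀ g : Fin n → Fin (n + 2),
      (φ.submatrix id g).det = ((φ.submatrix id e).submatrix id (e.symm ∘ g)).det := by
    intro g
    congr 1
    ext i j
    simp
  have hsub : I ≤ LefschetzRankTwo.minorIdeal (φ.submatrix id e) := by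
    rw [hI]
    refine Ideal.span_le.mpr ?_
    rintro _ ⟨g, -, rfl⟩
    rw [hminor]
    exact Ideal.subset_span ⟨e.symm ∘ g, rfl⟩
  obtain ⟨M, hM⟩ : ∃ M : ℕ, ∀ i, X i ^ M ∈ I := by
    rw [hI] at hht ⊢
    refine LefschetzRankTwo.exists_X_pow_mem ?_ hht
    rintro _ ⟨g, -, rfl⟩
    rw [hminor]
    exact ⟨_, LefschetzRankTwo.minor_mem_hcomp (a := a) (b := b ∘ e) hgr _⟩
  have hsum : ∑ j, b (e j) = ∑ j, b j := e.sum_comp b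
  have hlast : ∀ j, b j ≤ b ⟨n + 1, by omega⟩ := fun j => hb (Fin.le_def.mpr (by simp; omega))
  have hdd : d = d' + b ⟨n, by omega⟩ + b ⟨n + 1, by omega⟩ := by
    rw [hd, hd', Fin.sum_univ_castSucc, Fin.sum_univ_castSucc, Finset.sum_sub_distrib]
    simp only [Fin.castLE, Fin.castSucc, Fin.castAdd, Fin.last]
    ring
  obtain ⟨ℓ, hℓ, h⟩ := LefschetzRankTwo.exists_linForm_injective_or_surjective (a := a)
    (b := b ∘ e) hgr (fun i => hsub (hM i))
    (fun j => by
      have := hlast (e j)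
      simp only [Function.comp_apply, hsum]
      rw [← hd]
      rcases hcond with ⟨⟨k, hk⟩, h⟩ | ⟨⟨k, hk⟩, h⟩ <;> omega)
    (fun i => by
      by_contra! hi
      have hzero : ∀ j, φ i j = 0 := fun j => (hφ i j).resolve_right fun h => by
        have := hi (e.symm j)
        simp only [Function.comp_apply, Equiv.apply_symm_apply] at this
        omega
      have hbot : I ≤ ⊥ := by
        rw [hI]
        refine Ideal.span_le.mpr ?_
        rintro _ ⟨g, -, rfl⟩
        exact Matrix.det_eq_zero_of_row_eq_zero i fun j => hzero _
      exact pow_ne_zero M (X_ne_zero (R := K) 0) (hbot (hM 0)))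
  have hrange : ∀ g : Fin n → MvPolynomial (Fin 3) K,
      g ∈ LinearMap.range φ.mulVecLin ↔ ∃ f, (φ.submatrix id e).mulVec f = g := by
    intro g
    constructor
    · rintro ⟨f, rfl⟩
      exact ⟨f ∘ e, by rw [Matrix.submatrix_mulVec_equiv]; simp [Function.comp_assoc]⟩
    · rintro ⟨f, rfl⟩
      exact ⟨f ∘ e.symm, by rw [Matrix.submatrix_mulVec_equiv]; rfl⟩
  refine ⟨ℓ, hℓ, fun t => (h t).imp ?_ ?_⟩
  · intro hinj x hx hx0
    obtain ⟨g, hg, rfl⟩ := LefschetzRankTwo.mem_cokerPiece.mp hx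
    rw [← Submodule.Quotient.mk_smul, Submodule.Quotient.mk_eq_zero, hrange] at hx0
    rw [Submodule.Quotient.mk_eq_zero, hrange]
    exact hinj g hg hx0
  · intro hsurj y hy
    obtain ⟨g, hg, rfl⟩ := LefschetzRankTwo.mem_cokerPiece.mp hy
    obtain ⟨g', hg', f, hf⟩ := hsurj g hg
    refine ⟨Submodule.Quotient.mk g', LefschetzRankTwo.mem_cokerPiece.mpr ⟨g', hg', rfl⟩, ?_⟩
    rw [← Submodule.Quotient.mk_smul, ← hf, eq_comm, Submodule.Quotient.eq, add_sub_cancel_right,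
      hrange]
    exact ⟨f, rfl⟩
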